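/- The sequence 0 → ℂ* → êP(ℂ) → P(ℂ) → 0 is exact, where êP(ℂ) → P(ℂ) is the natural map [z,p,q] ↦ [z] and ℂ* → êP(ℂ) is an injective group homomorphism χ satisfying χ(z) = [z,0,1] - [z,0,0] for z ∈ ℂ∖{0,1}; in particular the kernel of êP(ℂ) → P(ℂ) is isomorphic to ℂ* via χ. -/

import Mathlib

open Complex
open scoped Classical

noncomputable section

namespace ExtendedBloch

/-- `π` as a complex number. -/
def Cpi : ℂ := (Real.pi : ℂ)

/-- Membership in `ℂ ∖ {0,1}`. -/
def Reg (z : ℂ) : Prop := z ≠ 0 ∧ z ≠ 1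

/-- The open upper half plane. -/
def UHP : Set ℂ := {z : ℂ | 0 < z.im}

/-- The 5-tuple occurring in the five term relation. -/
def ftTuple (x y : ℂ) : Fin 5 → ℂ :=
  ![x, y, y / x, (1 - x⁻¹) / (1 - y⁻¹), (1 - x) / (1 - y)]

/-- The set `FT` of five term tuples. -/
def FT : Set (Fin 5 → ℂ) :=
  {v | ∃ x y : ℂ, Reg x ∧ Reg y ∧ x ≠ y ∧ v = ftTuple x y}

/-- The subset `FT⁺` of tuples with all coordinates in the upper half plane. -/
def FTplus : Set (Fin 5 → ℂ) := {v | v ∈ FT ∧ ∀ i, v i ∈ UHP}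

/-- The point `(z; p, q)` of the cover `𝓒` of `ℂ ∖ {0,1}`, realized concretely as the pair of
branch values `(log z + pπi, -log(1-z) + qπi)` (Riemann surface model of `𝓒`). -/
def pt (z : ℂ) (p q : ℤ) : ℂ × ℂ :=
  (Complex.log z + p * (Cpi * I), -Complex.log (1 - z) + q * (Cpi * I))

/-- The cover `𝓒`, realized as the Riemann surface of all branches of
`(log z + pπi, -log(1-z) + qπi)` on `ℂ ∖ {0,1}`. -/
def Cover : Set (ℂ × ℂ) := {w | ∃ z : ℂ, Reg z ∧ ∃ p q : ℤ, w = pt z p q}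

lemma pt_mem_Cover {z : ℂ} (h : Reg z) (p q : ℤ) : pt z p q ∈ Cover :=
  ⟨z, h, p, q, rfl⟩

/-- `w ∈ 𝓒` lies over `z ∈ ℂ ∖ {0,1}`. -/
def LiesOver (w : ℂ × ℂ) (z : ℂ) : Prop := Reg z ∧ ∃ p q : ℤ, w = pt z p q

/-- The covering action of `ℤ × ℤ` on `𝓒`. -/
def covAct (v : ℤ × ℤ) (w : ℂ × ℂ) : ℂ × ℂ :=
  (w.1 + v.1 * (Cpi * I), w.2 + v.2 * (Cpi * I))

/-- The subset `V ⊂ (ℤ × ℤ)⁵`. -/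
def Vset : Set (Fin 5 → ℤ × ℤ) :=
  {v | ∃ p₀ p₁ q₀ q₁ q₂ : ℤ,
    v = ![(p₀, q₀), (p₁, q₁), (p₁ - p₀, q₂), (p₁ - p₀ + q₁ - q₀, q₂ - q₁),
          (q₁ - q₀, q₂ - q₁ - p₀)]}

/-- The preimage of `FT` in `𝓒⁵`. -/
def FTpre : Set (Fin 5 → ℂ × ℂ) := {w | ∃ v ∈ FT, ∀ i, LiesOver (w i) (v i)}

/-- A base point `((x₀;0,0),…,(x₄;0,0))` with `(x₀,…,x₄) ∈ FT⁺`. -/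
def basePt : Fin 5 → ℂ × ℂ := fun i => pt (ftTuple ((1 + I) / 4) I i) 0 0

/-- `𝓕𝓣̂₀`: the connected component of the preimage of `FT` in `𝓒⁵` containing the points
`((x₀;0,0),…,(x₄;0,0))` with `(x₀,…,x₄) ∈ FT⁺`. -/
def FThat₀ : Set (Fin 5 → ℂ × ℂ) := connectedComponentIn FTpre basePt

/-- `𝓕𝓣̂ = 𝓕𝓣̂₀ + V`. -/
def FThat : Set (Fin 5 → ℂ × ℂ) :=
  {u | ∃ w ∈ FThat₀, ∃ v ∈ Vset, u = fun i => covAct (v i) (w i)}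

abbrev CoverT : Type := ↥Cover

/-- The generator `(z; p, q)` of the free abelian group on `𝓒`. -/
def genOf (z : ℂ) (h : Reg z) (p q : ℤ) : FreeAbelianGroup CoverT :=
  FreeAbelianGroup.of ⟨pt z p q, pt_mem_Cover h p q⟩

/-- The lifted five term relators. -/
def FiveTermRels : Set (FreeAbelianGroup CoverT) :=
  {a | ∃ w : Fin 5 → ℂ × ℂ, w ∈ FThat ∧ ∃ hc : ∀ i, w i ∈ Cover,
    a = ∑ i : Fin 5, (-1 : ℤ) ^ (i : ℕ) • FreeAbelianGroup.of (⟨w i, hc i⟩ : CoverT)}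

/-- The transfer relators. -/
def TransferRels : Set (FreeAbelianGroup CoverT) :=
  {a | ∃ z : ℂ, ∃ h : Reg z, ∃ p q p' q' : ℤ,
    a = genOf z h p q + genOf z h p' q' - genOf z h p q' - genOf z h p' q}

def relSub : AddSubgroup (FreeAbelianGroup CoverT) :=
  AddSubgroup.closure (FiveTermRels ∪ TransferRels)

def relSub' : AddSubgroup (FreeAbelianGroup CoverT) :=
  AddSubgroup.closure FiveTermRels

/-- The extended pre-Bloch group `êP(ℂ)`. -/
abbrev EPreBloch : Type := FreeAbelianGroup CoverT ⧸ relSub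

/-- The variant `êP'(ℂ)` without the transfer relations. -/
abbrev EPreBloch' : Type := FreeAbelianGroup CoverT ⧸ relSub'

/-- The class `[z, p, q] ∈ êP(ℂ)` (junk value `0` if `z ∈ {0,1}`). -/
def cls (z : ℂ) (p q : ℤ) : EPreBloch :=
  if h : Reg z then QuotientAddGroup.mk (genOf z h p q) else 0

/-- The class `[z, p, q] ∈ êP'(ℂ)` (junk value `0` if `z ∈ {0,1}`). -/
def cls' (z : ℂ) (p q : ℤ) : EPreBloch' :=
  if h : Reg z then QuotientAddGroup.mk (genOf z h p q) else 0

/-- `ℂ ∧_ℤ ℂ`, the second exterior power of `ℂ` as a `ℤ`-module. -/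
abbrev L2C : Type := ↥(⋀[ℤ]^2 ℂ)

/-- The wedge `a ∧ b ∈ ℂ ∧_ℤ ℂ`. -/
def wedge (a b : ℂ) : L2C :=
  ⟨ExteriorAlgebra.ιMulti ℤ 2 ![a, b],
   ExteriorAlgebra.ιMulti_range ℤ 2 (Set.mem_range_self _)⟩

def nuFree : FreeAbelianGroup CoverT →+ L2C :=
  FreeAbelianGroup.lift fun w : CoverT => wedge w.1.1 w.1.2

/-- The homomorphism `ν : êP(ℂ) → ℂ ∧_ℤ ℂ`. -/
def nuHom : EPreBloch →+ L2C :=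
  if h : ∀ a ∈ relSub, nuFree a = 0 then QuotientAddGroup.lift relSub nuFree h else 0

/-- The homomorphism `ν : êP'(ℂ) → ℂ ∧_ℤ ℂ`. -/
def nuHom' : EPreBloch' →+ L2C :=
  if h : ∀ a ∈ relSub', nuFree a = 0 then QuotientAddGroup.lift relSub' nuFree h else 0

/-- The extended Bloch group `êB(ℂ) = ker ν`. -/
def EBloch : AddSubgroup EPreBloch := nuHom.ker

/-- `êB'(ℂ) = ker ν` on `êP'(ℂ)`. -/
def EBloch' : AddSubgroup EPreBloch' := nuHom'.ker

/-- The component `X₀₀` of `𝓒` (both fiber coordinates even). -/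
def X00 : Set (ℂ × ℂ) := {w | ∃ z : ℂ, Reg z ∧ ∃ p q : ℤ, w = pt z (2 * p) (2 * q)}

abbrev X00T : Type := ↥X00

lemma pt_mem_X00 {z : ℂ} (h : Reg z) (p q : ℤ) : pt z (2 * p) (2 * q) ∈ X00 :=
  ⟨z, h, p, q, rfl⟩

/-- The generator `(z; 2p, 2q)` of the free abelian group on `X₀₀`. -/
def genOf₀ (z : ℂ) (h : Reg z) (p q : ℤ) : FreeAbelianGroup X00T :=
  FreeAbelianGroup.of ⟨pt z (2 * p) (2 * q), pt_mem_X00 h p q⟩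

/-- The five term relators coming from `𝓕𝓣̂ ∩ (X₀₀)⁵`. -/
def FiveTermRels₀ : Set (FreeAbelianGroup X00T) :=
  {a | ∃ w : Fin 5 → ℂ × ℂ, w ∈ FThat ∧ ∃ hc : ∀ i, w i ∈ X00,
    a = ∑ i : Fin 5, (-1 : ℤ) ^ (i : ℕ) • FreeAbelianGroup.of (⟨w i, hc i⟩ : X00T)}

def relSub₀ : AddSubgroup (FreeAbelianGroup X00T) := AddSubgroup.closure FiveTermRels₀

/-- The true extended pre-Bloch group `êêP(ℂ)`. -/
abbrev EEPreBloch : Type := FreeAbelianGroup X00T ⧸ relSub₀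

/-- The class `[z, 2p, 2q] ∈ êêP(ℂ)` (junk value `0` if `z ∈ {0,1}`). -/
def cls₀ (z : ℂ) (p q : ℤ) : EEPreBloch :=
  if h : Reg z then QuotientAddGroup.mk (genOf₀ z h p q) else 0

def nuFree₀ : FreeAbelianGroup X00T →+ L2C :=
  FreeAbelianGroup.lift fun w : X00T => wedge w.1.1 w.1.2

/-- The homomorphism `ν̂ : êêP(ℂ) → ℂ ∧_ℤ ℂ`. -/
def nuHom₀ : EEPreBloch →+ L2C :=
  if h : ∀ a ∈ relSub₀, nuFree₀ a = 0 then QuotientAddGroup.lift relSub₀ nuFree₀ h else 0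

/-- The true extended Bloch group `êêB(ℂ) = ker ν̂`. -/
def EEBloch : AddSubgroup EEPreBloch := nuHom₀.ker

/-- The Rogers dilogarithm `𝓡(z) = ½ log z log(1-z) - ∫₀ᶻ log(1-t)/t dt` (straight segment,
parametrized by `t = s z`). -/
def rogers (z : ℂ) : ℂ :=
  (1 / 2) * Complex.log z * Complex.log (1 - z) -
    ∫ s in (0:ℝ)..(1:ℝ), Complex.log (1 - (s : ℂ) * z) / (s : ℂ)

/-- `R(z; p, q) = 𝓡(z) + (πi/2)(p log(1-z) + q log z) - π²/6`. -/
def Rfun (z : ℂ) (p q : ℤ) : ℂ :=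
  rogers z + (Cpi * I / 2) * (p * Complex.log (1 - z) + q * Complex.log z) - Cpi ^ 2 / 6

/-- `R̂(z; 2p, 2q) = 𝓡(z) + πi(p log(1-z) + q log z) - π²/6`. -/
def Rhat (z : ℂ) (p q : ℤ) : ℂ :=
  rogers z + Cpi * I * (p * Complex.log (1 - z) + q * Complex.log z) - Cpi ^ 2 / 6

/-- `ℂ / π²ℤ`. -/
abbrev ModPiSq : Type := ℂ ⧸ AddSubgroup.zmultiples (Cpi ^ 2)

/-- `ℂ / 2π²ℤ`. -/
abbrev Mod2PiSq : Type := ℂ ⧸ AddSubgroup.zmultiples (2 * Cpi ^ 2)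

abbrev RegT : Type := {z : ℂ // Reg z}

def pbGen (z : ℂ) (h : Reg z) : FreeAbelianGroup RegT := FreeAbelianGroup.of ⟨z, h⟩

/-- The five term relators for the classical pre-Bloch group. -/
def pbRels : Set (FreeAbelianGroup RegT) :=
  {a | ∃ x y : ℂ, ∃ hx : Reg x, ∃ hy : Reg y, x ≠ y ∧
    ∃ h2 : Reg (y / x), ∃ h3 : Reg ((1 - x⁻¹) / (1 - y⁻¹)), ∃ h4 : Reg ((1 - x) / (1 - y)),
    a = pbGen x hx - pbGen y hy + pbGen (y / x) h2 -
        pbGen ((1 - x⁻¹) / (1 - y⁻¹)) h3 + pbGen ((1 - x) / (1 - y)) h4}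

def pbSub : AddSubgroup (FreeAbelianGroup RegT) := AddSubgroup.closure pbRels

/-- The classical pre-Bloch group `P(ℂ)`. -/
abbrev PreBloch : Type := FreeAbelianGroup RegT ⧸ pbSub

/-- The class `[z] ∈ P(ℂ)` (junk value `0` if `z ∈ {0,1}`). -/
def pbCls (z : ℂ) : PreBloch :=
  if h : Reg z then QuotientAddGroup.mk (pbGen z h) else 0

/-- `ℂ* ∧_ℤ ℂ*`, the second exterior power of the multiplicative group `ℂ*` as `ℤ`-module. -/
abbrev L2CU : Type := ↥(⋀[ℤ]^2 (Additive ℂˣ))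

/-- The wedge `a ∧ b ∈ ℂ* ∧_ℤ ℂ*`. -/
def wedgeU (a b : ℂˣ) : L2CU :=
  ⟨ExteriorAlgebra.ιMulti ℤ 2 ![Additive.ofMul a, Additive.ofMul b],
   ExteriorAlgebra.ιMulti_range ℤ 2 (Set.mem_range_self _)⟩

def nuPBFree : FreeAbelianGroup RegT →+ L2CU :=
  FreeAbelianGroup.lift fun z : RegT =>
    2 • wedgeU (Units.mk0 z.1 z.2.1) (Units.mk0 (1 - z.1) (sub_ne_zero_of_ne (Ne.symm z.2.2)))

/-- The homomorphism `P(ℂ) → ℂ* ∧_ℤ ℂ*`, `[z] ↦ 2 (z ∧ (1-z))`. -/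
def nuPB : PreBloch →+ L2CU :=
  if h : ∀ a ∈ pbSub, nuPBFree a = 0 then QuotientAddGroup.lift pbSub nuPBFree h else 0

/-- The classical Bloch group `B(ℂ)`. -/
def Bloch : AddSubgroup PreBloch := nuPB.ker

/-- The roots of unity in `ℂ*`. -/
def muStar : Set ℂˣ := {ζ | ∃ n : ℕ, 0 < n ∧ ζ ^ n = 1}

abbrev SL2C := Matrix.SpecialLinearGroup (Fin 2) ℂ

/-- `PSL(2,ℂ) = SL(2,ℂ)/{±1}` as a discrete group. -/
abbrev PSL2C := SL2C ⧸ Subgroup.center SL2C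

/-- The boundary map `C₃ → C₂` of the inhomogeneous bar complex computing `H₃(PSL(2,ℂ);ℤ)`. -/
def d3 : FreeAbelianGroup (Fin 3 → PSL2C) →+ FreeAbelianGroup (Fin 2 → PSL2C) :=
  FreeAbelianGroup.lift fun g =>
    FreeAbelianGroup.of ![g 1, g 2] - FreeAbelianGroup.of ![g 0 * g 1, g 2] +
      FreeAbelianGroup.of ![g 0, g 1 * g 2] - FreeAbelianGroup.of ![g 0, g 1]

/-- The boundary map `C₄ → C₃` of the inhomogeneous bar complex computing `H₃(PSL(2,ℂ);ℤ)`. -/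
def d4 : FreeAbelianGroup (Fin 4 → PSL2C) →+ FreeAbelianGroup (Fin 3 → PSL2C) :=
  FreeAbelianGroup.lift fun g =>
    FreeAbelianGroup.of ![g 1, g 2, g 3] - FreeAbelianGroup.of ![g 0 * g 1, g 2, g 3] +
      FreeAbelianGroup.of ![g 0, g 1 * g 2, g 3] - FreeAbelianGroup.of ![g 0, g 1, g 2 * g 3] +
      FreeAbelianGroup.of ![g 0, g 1, g 2]

/-- `H₃(PSL(2,ℂ);ℤ)`, defined as homology of the inhomogeneous bar complex. -/
abbrev H3PSL2C : Type := ↥d3.ker ⧸ ((d4.range).addSubgroupOf d3.ker)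

/-- The set of combinatorial flattenings. -/
def Flattenings : Set (ℂ × ℂ × ℂ) :=
  {w | w.1 + w.2.1 + w.2.2 = 0 ∧ ∃ z : ℂ, Reg z ∧ ∃ p q r : ℤ,
    w.1 = Complex.log z + p * (Cpi * I) ∧
    w.2.1 = -Complex.log (1 - z) + q * (Cpi * I) ∧
    w.2.2 = Complex.log (1 - z) - Complex.log z + r * (Cpi * I)}

/-- The map `ℓ : 𝓒 → ℂ³`. -/
def ellMap (w : ℂ × ℂ) : ℂ × ℂ × ℂ := (w.1, w.2, -w.1 - w.2)

/-- The element `κ = [x,1,1] + [x,0,0] - [x,1,0] - [x,0,1] ∈ êP'(ℂ)`. -/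
def kap (x : ℂ) : EPreBloch' := cls' x 1 1 + cls' x 0 0 - cls' x 1 0 - cls' x 0 1

/-- The natural projection `êP'(ℂ) → êP(ℂ)`. -/
def projP : EPreBloch' →+ EPreBloch :=
  QuotientAddGroup.map relSub' relSub (AddMonoidHom.id _)
    (by
      rw [AddSubgroup.comap_id]
      exact AddSubgroup.closure_mono Set.subset_union_left)

lemma one_sub_smul_mem_slitPlane {z : ℂ} (hz : 1 - z ∈ slitPlane) {t : ℝ} (h0 : 0 ≤ t)
    (h1 : t ≤ 1) : 1 - (t : ℂ) * z ∈ slitPlane := by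
  have h := starConvex_one_slitPlane hz (sub_nonneg.2 h1) h0 (by ring)
  convert h using 1
  simp only [real_smul, ofReal_sub, ofReal_one]
  ring

/-- The dilogarithm on `ℂ ∖ [1,∞)`. -/
def dilog (z : ℂ) : ℂ :=
  ∫ t in (0:ℝ)..1, z * dslope (fun w : ℂ => -Complex.log (1 - w)) 0 (t * z)

lemma isOpen_one_sub_slitPlane : IsOpen {z : ℂ | 1 - z ∈ slitPlane} :=
  isOpen_slitPlane.preimage (by fun_prop)

lemma dilog_integrand_continuousOn {z : ℂ} (hz : 1 - z ∈ slitPlane) :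
    ContinuousOn (fun t : ℝ => z * dslope (fun w : ℂ => -Complex.log (1 - w)) 0 (t * z))
      (Set.Icc 0 1) := by
  have h0 : {z : ℂ | 1 - z ∈ slitPlane} ∈ nhds (0 : ℂ) :=
    isOpen_one_sub_slitPlane.mem_nhds (by simp)
  have hd : DifferentiableOn ℂ (fun w : ℂ => -Complex.log (1 - w)) {z : ℂ | 1 - z ∈ slitPlane} := by
    intro w hw
    exact ((differentiableAt_id.const_sub 1).clog hw).neg.differentiableWithinAt
  have hc := ((Complex.differentiableOn_dslope h0).2 hd).continuousOn
  refine continuousOn_const.mul (hc.comp (by fun_prop) ?_)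
  intro t ht
  exact one_sub_smul_mem_slitPlane hz ht.1 ht.2

lemma integral_inv_one_sub {z : ℂ} (hz : 1 - z ∈ slitPlane) (h0 : z ≠ 0) :
    ∫ t in (0:ℝ)..1, (1 - (t : ℂ) * z)⁻¹ = -Complex.log (1 - z) / z := by
  have hs : ∀ t ∈ Set.uIcc (0:ℝ) 1, 1 - (t : ℂ) * z ∈ slitPlane := by
    intro t ht
    rw [Set.uIcc_of_le zero_le_one] at ht
    exact one_sub_smul_mem_slitPlane hz ht.1 ht.2
  have h := intervalIntegral.integral_eq_sub_of_hasDerivAt (a := 0) (b := 1)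
    (f := fun t : ℝ => -Complex.log (1 - (t : ℂ) * z) / z)
    (f' := fun t : ℝ => (1 - (t : ℂ) * z)⁻¹) ?_ ?_
  · rw [h]; simp
  · intro t ht
    have h1 : HasDerivAt (fun t : ℝ => 1 - (t : ℂ) * z) (-z) t := by
      simpa using ((Complex.ofRealCLM.hasDerivAt (x := t)).mul_const z).const_sub 1
    have h2 := ((h1.clog_real (hs t ht)).neg).div_const z
    refine h2.congr_deriv ?_
    have := slitPlane_ne_zero (hs t ht)
    field_simp
  · apply ContinuousOn.intervalIntegrable
    exact ContinuousOn.inv₀ (by fun_prop) fun t ht => slitPlane_ne_zero (hs t ht)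

lemma hasDerivAt_dilog {z : ℂ} (hz : 1 - z ∈ slitPlane) (h0 : z ≠ 0) :
    HasDerivAt dilog (-Complex.log (1 - z) / z) z := by
  obtain ⟨r, hr, hsub⟩ := Metric.nhds_basis_closedBall.mem_iff.1
    (isOpen_one_sub_slitPlane.mem_nhds hz)
  have hcont : ContinuousOn (fun p : ℂ × ℝ => (1 - (p.2 : ℂ) * p.1)⁻¹)
      (Metric.closedBall z r ×ˢ Set.Icc (0:ℝ) 1) := by
    refine ContinuousOn.inv₀ (by fun_prop) ?_
    rintro ⟨w, t⟩ ⟨hw, ht⟩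
    exact slitPlane_ne_zero (one_sub_smul_mem_slitPlane (hsub hw) ht.1 ht.2)
  obtain ⟨C, hC⟩ := ((isCompact_closedBall z r).prod isCompact_Icc).exists_bound_of_continuousOn
    hcont
  have hioc : Set.uIoc (0:ℝ) 1 = Set.Ioc 0 1 := Set.uIoc_of_le zero_le_one
  have key := (intervalIntegral.hasDerivAt_integral_of_dominated_loc_of_deriv_le
    (μ := MeasureTheory.volume) (a := 0) (b := 1)
    (F := fun w (t : ℝ) => w * dslope (fun w : ℂ => -Complex.log (1 - w)) 0 (t * w))
    (F' := fun w (t : ℝ) => (1 - (t : ℂ) * w)⁻¹) (x₀ := z) (bound := fun _ => C)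
    (Metric.ball_mem_nhds z hr) ?_ ?_ ?_ ?_ ?_ ?_).2
  · rw [integral_inv_one_sub hz h0] at key
    exact key
  · filter_upwards [Metric.ball_mem_nhds z hr] with w hw
    rw [hioc]
    exact ((dilog_integrand_continuousOn (hsub (Metric.ball_subset_closedBall hw))).mono
      Set.Ioc_subset_Icc_self).aestronglyMeasurable measurableSet_Ioc
  · apply ContinuousOn.intervalIntegrable
    rw [Set.uIcc_of_le zero_le_one]
    exact dilog_integrand_continuousOn hz
  · rw [hioc]
    refine ContinuousOn.aestronglyMeasurable ?_ measurableSet_Ioc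
    refine ContinuousOn.inv₀ (by fun_prop) fun t ht => ?_
    exact slitPlane_ne_zero (one_sub_smul_mem_slitPlane hz ht.1.le ht.2)
  · refine Filter.Eventually.of_forall fun t ht w hw => ?_
    rw [hioc] at ht
    exact hC (w, t) ⟨Metric.ball_subset_closedBall hw, ht.1.le, ht.2⟩
  · exact intervalIntegrable_const
  · refine Filter.Eventually.of_forall fun t ht w hw => ?_
    rw [hioc] at ht
    have ht0 : (t : ℂ) ≠ 0 := by exact_mod_cast ht.1.ne'
    have hw' := one_sub_smul_mem_slitPlane (hsub (Metric.ball_subset_closedBall hw)) ht.1.le ht.2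
    have h1 : HasDerivAt (fun w : ℂ => 1 - (t : ℂ) * w) (-t) w := by
      simpa using ((hasDerivAt_id w).const_mul (t : ℂ)).const_sub 1
    have h2 := ((h1.clog hw').neg).div_const (t : ℂ)
    have h3 : (fun w : ℂ => w * dslope (fun w : ℂ => -Complex.log (1 - w)) 0 (t * w)) =
        fun w : ℂ => -Complex.log (1 - (t : ℂ) * w) / t := by
      funext w
      rcases eq_or_ne w 0 with rfl | hw0
      · simp
      · rw [dslope_of_ne _ (mul_ne_zero ht0 hw0), slope_def_field]
        simp
        field_simp
    rw [h3]
    refine h2.congr_deriv ?_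
    have := slitPlane_ne_zero hw'
    field_simp

lemma exists_dilog_reflection : ∃ c : ℂ, ∀ z : ℂ, z ∈ slitPlane → 1 - z ∈ slitPlane →
    dilog z + dilog (1 - z) + Complex.log z * Complex.log (1 - z) = c := by
  have hopen : IsOpen (slitPlane ∩ {z : ℂ | 1 - z ∈ slitPlane}) :=
    isOpen_slitPlane.inter isOpen_one_sub_slitPlane
  have hstar : StarConvex ℝ (1 / 2 : ℂ) (slitPlane ∩ {z : ℂ | 1 - z ∈ slitPlane}) := by
    have h1 : StarConvex ℝ (1 / 2 : ℂ) slitPlane := by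
      simpa using starConvex_ofReal_slitPlane (x := 1 / 2) (by norm_num)
    refine h1.inter ?_
    intro z hz a b ha hb hab
    have := h1 hz ha hb hab
    have e : (a : ℂ) + b = 1 := by exact_mod_cast hab
    have e' : 1 - (a • (1 / 2 : ℂ) + b • z) = a • (1 / 2 : ℂ) + b • (1 - z) := by
      simp only [real_smul]
      linear_combination -e
    show 1 - (a • (1 / 2 : ℂ) + b • z) ∈ slitPlane
    rwa [e']
  have hderiv : ∀ z ∈ slitPlane ∩ {z : ℂ | 1 - z ∈ slitPlane},
      HasDerivAt (fun z => dilog z + dilog (1 - z) + Complex.log z * Complex.log (1 - z)) 0 z := by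
    rintro z ⟨hz, hz'⟩
    have hz' : 1 - z ∈ slitPlane := hz'
    have n0 := slitPlane_ne_zero hz
    have n1 := slitPlane_ne_zero hz'
    have hs : HasDerivAt (fun z : ℂ => 1 - z) (-1) z := (hasDerivAt_id z).const_sub 1
    have h2 := (hasDerivAt_dilog (z := 1 - z) (by simpa using hz) n1).comp z hs
    have h := ((hasDerivAt_dilog hz' n0).add h2).add
      ((hasDerivAt_log hz).mul (hs.clog hz'))
    refine h.congr_deriv ?_
    rw [sub_sub_cancel]
    field_simp
    ring
  obtain ⟨c, hc⟩ := hopen.exists_is_const_of_deriv_eq_zero (𝕜 := ℂ)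
    (hstar.isPathConnected ⟨by simp [slitPlane], by simp [slitPlane]; norm_num⟩).isConnected.isPreconnected
    (fun z hz => (hderiv z hz).differentiableAt.differentiableWithinAt)
    (fun z hz => (hderiv z hz).deriv)
  exact ⟨c, fun z h h' => hc z ⟨h, h'⟩⟩

lemma Cpi_ne_zero : Cpi ≠ 0 := by
  simp [Cpi, Real.pi_ne_zero]

lemma exp_log_add_even {z : ℂ} (hz : z ≠ 0) (k : ℤ) :
    Complex.exp (Complex.log z + ((2 * k : ℤ) : ℂ) * (Cpi * I)) = z := by
  rw [Complex.exp_add, Complex.exp_log hz]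
  have : ((2 * k : ℤ) : ℂ) * (Cpi * I) = k * (2 * Real.pi * I) := by
    simp only [Cpi]; push_cast; ring
  rw [this, Complex.exp_int_mul_two_pi_mul_I, mul_one]

lemma exists_eq_log_add_even {u z : ℂ} (h : Complex.exp u = z) :
    ∃ k : ℤ, u = Complex.log z + ((2 * k : ℤ) : ℂ) * (Cpi * I) := by
  have hz : z ≠ 0 := h ▸ Complex.exp_ne_zero u
  rw [← Complex.exp_log hz, Complex.exp_eq_exp_iff_exists_int] at h
  obtain ⟨k, hk⟩ := h
  exact ⟨k, by rw [hk]; simp only [Cpi]; push_cast; ring⟩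

lemma exists_eq_pt_even {z : ℂ} {w : ℂ × ℂ} (h1 : Complex.exp w.1 = z)
    (h2 : Complex.exp (-w.2) = 1 - z) : Reg z ∧ ∃ k m : ℤ, w = pt z (2 * k) (2 * m) := by
  have hz : z ≠ 0 := h1 ▸ Complex.exp_ne_zero _
  have hz' : 1 - z ≠ 0 := h2 ▸ Complex.exp_ne_zero _
  obtain ⟨k, hk⟩ := exists_eq_log_add_even h1
  obtain ⟨m, hm⟩ := exists_eq_log_add_even h2
  refine ⟨⟨hz, fun h => hz' (by rw [h, sub_self])⟩, k, -m, Prod.ext hk ?_⟩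
  simp only [pt]
  push_cast at hm ⊢
  linear_combination -hm

/-- The even sheet `{(u, v) | e^u + e^{-v} = 1}` of the cover. -/
def EvenSheet : Set (ℂ × ℂ) := {w | Complex.exp w.1 + Complex.exp (-w.2) = 1}

lemma pt_even_exp {z : ℂ} (h : Reg z) (k m : ℤ) :
    Complex.exp (pt z (2 * k) (2 * m)).1 = z ∧
      Complex.exp (-(pt z (2 * k) (2 * m)).2) = 1 - z := by
  refine ⟨exp_log_add_even h.1 k, ?_⟩
  rw [← exp_log_add_even (sub_ne_zero.2 h.2.symm) (-m)]
  simp only [pt]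
  congr 1
  push_cast
  ring

lemma mk_eq_of_sub_eq_int_mul {a b : ℂ} (n : ℤ) (h : a - b = n * Cpi ^ 2) :
    (QuotientAddGroup.mk a : ModPiSq) = QuotientAddGroup.mk b := by
  rw [QuotientAddGroup.eq, AddSubgroup.mem_zmultiples_iff]
  exact ⟨-n, by rw [zsmul_eq_mul]; push_cast; linear_combination h⟩

/-- The constant in the reflection formula of the dilogarithm. -/
def reflectionConst : ℂ := exists_dilog_reflection.choose

lemma dilog_reflection {z : ℂ} (h : z ∈ slitPlane) (h' : 1 - z ∈ slitPlane) :
    dilog z + dilog (1 - z) + Complex.log z * Complex.log (1 - z) = reflectionConst :=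
  exists_dilog_reflection.choose_spec z h h'

/-- The Rogers dilogarithm on `(z; p, q)`, up to an additive constant. -/
def rogersLift (z : ℂ) (p q : ℤ) : ℂ :=
  (if 1 - z ∈ slitPlane then dilog z + Complex.log z * Complex.log (1 - z) / 2
    else reflectionConst - dilog (1 - z) - Complex.log z * Complex.log (1 - z) / 2) +
  (Cpi * I / 2) * (p * Complex.log (1 - z) + q * Complex.log z)

/-- Formula for the lifted Rogers dilogarithm away from the cut `[1,∞)`. -/
def chartZero (w : ℂ × ℂ) : ℂ :=
  dilog (Complex.exp w.1) + w.1 * w.2 / 2 + w.1 * Complex.log (1 - Complex.exp w.1)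

/-- Formula for the lifted Rogers dilogarithm away from the cut `(-∞,0]`. -/
def chartOne (w : ℂ × ℂ) : ℂ :=
  reflectionConst - dilog (1 - Complex.exp w.1) - w.1 * w.2 / 2 +
    w.2 * Complex.log (Complex.exp w.1)

lemma mk_rogersLift_eq_chartZero {z : ℂ} (h : Reg z) (hz : 1 - z ∈ slitPlane) (k m : ℤ) :
    (QuotientAddGroup.mk (rogersLift z (2 * k) (2 * m)) : ModPiSq) =
      QuotientAddGroup.mk (chartZero (pt z (2 * k) (2 * m))) := by
  refine mk_eq_of_sub_eq_int_mul (2 * k * m) ?_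
  rw [rogersLift, chartZero, (pt_even_exp h k m).1, if_pos hz]
  simp only [pt]
  push_cast
  linear_combination (-2 * k * m * Cpi ^ 2) * I_sq

lemma mk_rogersLift_eq_chartOne {z : ℂ} (h : Reg z) (hz : z ∈ slitPlane) (k m : ℤ) :
    (QuotientAddGroup.mk (rogersLift z (2 * k) (2 * m)) : ModPiSq) =
      QuotientAddGroup.mk (chartOne (pt z (2 * k) (2 * m))) := by
  refine mk_eq_of_sub_eq_int_mul (-2 * k * m) ?_
  have key : (if 1 - z ∈ slitPlane then dilog z + Complex.log z * Complex.log (1 - z) / 2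
    else reflectionConst - dilog (1 - z) - Complex.log z * Complex.log (1 - z) / 2) =
      reflectionConst - dilog (1 - z) - Complex.log z * Complex.log (1 - z) / 2 := by
    split_ifs with h'
    · linear_combination dilog_reflection hz h'
    · rfl
  rw [rogersLift, chartOne, (pt_even_exp h k m).1, key]
  simp only [pt]
  push_cast
  linear_combination (2 * k * m * Cpi ^ 2) * I_sq

lemma deriv_relation_evenSheet {u v : ℂ → ℂ} {u' v' s : ℂ} (hu : HasDerivAt u u' s)
    (hv : HasDerivAt v v' s) (hX : ∀ᶠ t in nhds s, (u t, v t) ∈ EvenSheet) :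
    Complex.exp (u s) * u' = (1 - Complex.exp (u s)) * v' := by
  have h1 := hu.cexp.add hv.neg.cexp
  have h2 := (hasDerivAt_const s (1 : ℂ)).congr_of_eventuallyEq
    (f₁ := fun t => Complex.exp (u t) + Complex.exp (-v t)) hX
  have h3 := h1.unique h2
  have h4 : Complex.exp (u s) + Complex.exp (-v s) = 1 := hX.self_of_nhds
  rw [← h4, add_sub_cancel_left]
  simp only [Pi.neg_apply] at h3
  linear_combination h3

lemma hasDerivAt_chartZero {u v : ℂ → ℂ} {u' v' s : ℂ} (hu : HasDerivAt u u' s)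
    (hv : HasDerivAt v v' s) (hX : ∀ᶠ t in nhds s, (u t, v t) ∈ EvenSheet)
    (hs : 1 - Complex.exp (u s) ∈ slitPlane) :
    HasDerivAt (fun t => chartZero (u t, v t)) ((v s * u' - u s * v') / 2) s := by
  have hrel := deriv_relation_evenSheet hu hv hX
  have n0 := Complex.exp_ne_zero (u s)
  have n1 := slitPlane_ne_zero hs
  have h1 := (hasDerivAt_dilog hs n0).comp s hu.cexp
  have h := (h1.add ((hu.mul hv).div_const 2)).add (hu.mul ((hu.cexp.const_sub 1).clog hs))
  refine h.congr_deriv ?_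
  have e : v' = Complex.exp (u s) * u' / (1 - Complex.exp (u s)) := by
    rw [hrel]; field_simp
  rw [e]
  field_simp
  ring

lemma hasDerivAt_chartOne {u v : ℂ → ℂ} {u' v' s : ℂ} (hu : HasDerivAt u u' s)
    (hv : HasDerivAt v v' s) (hX : ∀ᶠ t in nhds s, (u t, v t) ∈ EvenSheet)
    (hs : Complex.exp (u s) ∈ slitPlane) :
    HasDerivAt (fun t => chartOne (u t, v t)) ((v s * u' - u s * v') / 2) s := by
  have hrel := deriv_relation_evenSheet hu hv hX
  have n0 := Complex.exp_ne_zero (u s)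
  have n1 : 1 - Complex.exp (u s) ≠ 0 := by
    have h4 : Complex.exp (u s) + Complex.exp (-v s) = 1 := hX.self_of_nhds
    rw [← h4, add_sub_cancel_left]
    exact Complex.exp_ne_zero _
  have h1 := (hasDerivAt_dilog (z := 1 - Complex.exp (u s)) (by simpa using hs) n1).comp s
    (hu.cexp.const_sub 1)
  have h := ((h1.const_sub reflectionConst).sub ((hu.mul hv).div_const 2)).add
    (hv.mul (hu.cexp.clog hs))
  refine h.congr_deriv ?_
  have e : v' = Complex.exp (u s) * u' / (1 - Complex.exp (u s)) := by
    rw [hrel]; field_simp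
  rw [sub_sub_cancel, e]
  field_simp
  ring

/-- The lifted Rogers dilogarithm on the even sheet, modulo `π²`. -/
def rogersEven (w : ℂ × ℂ) : ModPiSq :=
  if 1 - Complex.exp w.1 ∈ slitPlane then QuotientAddGroup.mk (chartZero w)
  else QuotientAddGroup.mk (chartOne w)

lemma exists_eq_pt_of_mem_evenSheet {w : ℂ × ℂ} (hw : w ∈ EvenSheet) :
    Reg (Complex.exp w.1) ∧ ∃ k m : ℤ, w = pt (Complex.exp w.1) (2 * k) (2 * m) :=
  exists_eq_pt_even rfl (eq_sub_of_add_eq' hw)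

lemma mem_slitPlane_of_one_sub_notMem {z : ℂ} (h : 1 - z ∉ slitPlane) : z ∈ slitPlane := by
  simp only [mem_slitPlane_iff, sub_re, one_re, sub_im, one_im, zero_sub, neg_ne_zero,
    not_or, not_lt] at h
  exact Or.inl (by linarith [h.1])

lemma rogersEven_pt {z : ℂ} (h : Reg z) (k m : ℤ) :
    rogersEven (pt z (2 * k) (2 * m)) = QuotientAddGroup.mk (rogersLift z (2 * k) (2 * m)) := by
  rw [rogersEven, (pt_even_exp h k m).1]
  split_ifs with hz
  · exact (mk_rogersLift_eq_chartZero h hz k m).symm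
  · exact (mk_rogersLift_eq_chartOne h (mem_slitPlane_of_one_sub_notMem hz) k m).symm

lemma rogersEven_eq_chartOne {w : ℂ × ℂ} (hw : w ∈ EvenSheet)
    (h : Complex.exp w.1 ∈ slitPlane) : rogersEven w = QuotientAddGroup.mk (chartOne w) := by
  obtain ⟨hr, k, m, e⟩ := exists_eq_pt_of_mem_evenSheet hw
  generalize Complex.exp w.1 = z at *
  subst e
  rw [rogersEven_pt hr, mk_rogersLift_eq_chartOne hr h]

/-- Local holomorphic representatives of the lifted Rogers dilogarithm. -/
lemma exists_local_primitive {w₀ : ℂ × ℂ} : ∃ (r : ℂ × ℂ → ℂ) (N : Set ℂ),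
    IsOpen N ∧ Complex.exp w₀.1 ∈ N ∧
    (∀ w ∈ EvenSheet, Complex.exp w.1 ∈ N → rogersEven w = QuotientAddGroup.mk (r w)) ∧
    ∀ (u v : ℂ → ℂ) (u' v' s : ℂ), HasDerivAt u u' s → HasDerivAt v v' s →
      (∀ᶠ t in nhds s, (u t, v t) ∈ EvenSheet) → Complex.exp (u s) ∈ N →
      HasDerivAt (fun t => r (u t, v t)) ((v s * u' - u s * v') / 2) s := by
  by_cases hz : 1 - Complex.exp w₀.1 ∈ slitPlane
  · exact ⟨chartZero, {z | 1 - z ∈ slitPlane}, isOpen_one_sub_slitPlane, hz,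
      fun w _ h => if_pos h, fun u v u' v' s hu hv hX hs => hasDerivAt_chartZero hu hv hX hs⟩
  · exact ⟨chartOne, slitPlane, isOpen_slitPlane, mem_slitPlane_of_one_sub_notMem hz,
      fun w hw h => rogersEven_eq_chartOne hw h,
      fun u v u' v' s hu hv hX hs => hasDerivAt_chartOne hu hv hX hs⟩

/-- The arguments of the logarithms defining a flattening of the five term tuple at `(x, y)`. -/
def logArgs (x y : ℂ) : Fin 5 → ℂ := ![x, 1 - x, y, 1 - y, x - y]

/-- The flattening of a five term tuple with given logarithms of `x, 1 - x, y, 1 - y, x - y`. -/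
def flat (l : Fin 5 → ℂ) : Fin 5 → ℂ × ℂ :=
  ![(l 0, -l 1), (l 2, -l 3), (l 2 - l 0, l 0 - l 4), (l 2 - l 0 + l 1 - l 3, l 0 - l 4 + l 3),
    (l 1 - l 3, l 3 - l 4)]

/-- `l` consists of logarithms of `x, 1 - x, y, 1 - y, x - y`. -/
def IsLogTuple (x y : ℂ) (l : Fin 5 → ℂ) : Prop := ∀ j, Complex.exp (l j) = logArgs x y j

/-- The points `(x, y)` parametrizing `FT`. -/
def Valid (x y : ℂ) : Prop := Reg x ∧ Reg y ∧ x ≠ y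

lemma Valid.logArgs_ne_zero {x y : ℂ} (h : Valid x y) (j : Fin 5) : logArgs x y j ≠ 0 := by
  obtain ⟨hx, hy, hxy⟩ := h
  fin_cases j
  exacts [hx.1, sub_ne_zero.2 hx.2.symm, hy.1, sub_ne_zero.2 hy.2.symm, sub_ne_zero.2 hxy]

lemma IsLogTuple.valid {x y : ℂ} {l : Fin 5 → ℂ} (h : IsLogTuple x y l) : Valid x y := by
  have h' : ∀ j, logArgs x y j ≠ 0 := fun j => h j ▸ Complex.exp_ne_zero _
  have h0 := h' 0
  have h1 := h' 1
  have h2 := h' 2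
  have h3 := h' 3
  have h4 := h' 4
  simp only [logArgs, Matrix.cons_val] at h0 h1 h2 h3 h4
  exact ⟨⟨h0, (sub_ne_zero.1 h1).symm⟩, ⟨h2, (sub_ne_zero.1 h3).symm⟩, sub_ne_zero.1 h4⟩

lemma exp_flat {x y : ℂ} {l : Fin 5 → ℂ} (h : IsLogTuple x y l) (i : Fin 5) :
    Complex.exp (flat l i).1 = ftTuple x y i ∧
      Complex.exp (-(flat l i).2) = 1 - ftTuple x y i := by
  obtain ⟨⟨hx, hx'⟩, ⟨hy, hy'⟩, hxy⟩ := h.valid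
  have hx1 : x - 1 ≠ 0 := sub_ne_zero.2 hx'
  have hy1 : y - 1 ≠ 0 := sub_ne_zero.2 hy'
  have hx2 : 1 - x ≠ 0 := sub_ne_zero.2 hx'.symm
  have hy2 : 1 - y ≠ 0 := sub_ne_zero.2 hy'.symm
  have e0 : Complex.exp (l 0) = x := h 0
  have e1 : Complex.exp (l 1) = 1 - x := h 1
  have e2 : Complex.exp (l 2) = y := h 2
  have e3 : Complex.exp (l 3) = 1 - y := h 3
  have e4 : Complex.exp (l 4) = x - y := h 4
  have hyi : 1 - y⁻¹ ≠ 0 := by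
    rw [sub_ne_zero]; intro hh; exact hy' (by rw [← inv_inv y, ← hh, inv_one])
  fin_cases i <;>
    simp only [flat, ftTuple, Fin.zero_eta, Fin.mk_one, Fin.reduceFinMk, Matrix.cons_val,
      neg_sub, neg_neg, neg_add_rev, Complex.exp_sub, Complex.exp_add, Complex.exp_neg,
      e0, e1, e2, e3, e4]
  · exact ⟨trivial, trivial⟩
  · exact ⟨trivial, trivial⟩
  · exact ⟨trivial, by field_simp⟩
  · constructor <;> field_simp <;> ring
  · exact ⟨trivial, by field_simp; ring⟩

lemma flat_mem_evenSheet {x y : ℂ} {l : Fin 5 → ℂ} (h : IsLogTuple x y l) (i : Fin 5) :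
    flat l i ∈ EvenSheet := by
  show _ = _
  rw [(exp_flat h i).1, (exp_flat h i).2, add_sub_cancel]

lemma flat_eq_pt {x y : ℂ} {l : Fin 5 → ℂ} (h : IsLogTuple x y l) (i : Fin 5) :
    Reg (ftTuple x y i) ∧ ∃ k m : ℤ, flat l i = pt (ftTuple x y i) (2 * k) (2 * m) :=
  exists_eq_pt_even (exp_flat h i).1 (exp_flat h i).2

lemma Valid.exists_isLogTuple {x y : ℂ} (h : Valid x y) : ∃ l, IsLogTuple x y l :=
  ⟨fun j => Complex.log (logArgs x y j), fun j => Complex.exp_log (h.logArgs_ne_zero j)⟩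

lemma Valid.reg_ftTuple {x y : ℂ} (h : Valid x y) (i : Fin 5) : Reg (ftTuple x y i) :=
  let ⟨_, hl⟩ := h.exists_isLogTuple
  (flat_eq_pt hl i).1

/-- The alternating sum of the Rogers dilogarithm along a flattening. -/
def rogersSum (l : Fin 5 → ℂ) : ModPiSq := ∑ i : Fin 5, (-1 : ℤ) ^ (i : ℕ) • rogersEven (flat l i)

/-- The point at parameter `s` of the complex line from `a` to `b`. -/
def lineAt (a b s : ℂ) : ℂ := a + s * (b - a)

lemma rogersSum_locally_constant {x₀ y₀ x₁ y₁ s₀ : ℂ} {l : Fin 5 → ℂ}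
    (hl : IsLogTuple (lineAt x₀ x₁ s₀) (lineAt y₀ y₁ s₀) l) :
    ∀ᶠ s in nhds s₀, rogersSum (fun j => l j + Complex.log
      (logArgs (lineAt x₀ x₁ s) (lineAt y₀ y₁ s) j /
        logArgs (lineAt x₀ x₁ s₀) (lineAt y₀ y₁ s₀) j)) = rogersSum l := by
  set f : ℂ → Fin 5 → ℂ := fun s => logArgs (lineAt x₀ x₁ s) (lineAt y₀ y₁ s) with hf
  have hfd : ∀ j, Differentiable ℂ fun s => f s j := by
    intro j
    fin_cases j <;> simp [hf, logArgs, lineAt]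
  have hne : ∀ j, f s₀ j ≠ 0 := hl.valid.logArgs_ne_zero
  set L : ℂ → Fin 5 → ℂ := fun s j => l j + Complex.log (f s j / f s₀ j) with hL
  have hL0 : L s₀ = l := by
    funext j; simp [hL, div_self (hne j)]
  have hev : ∀ᶠ s in nhds s₀, ∀ j, f s j / f s₀ j ∈ slitPlane := by
    rw [Filter.eventually_all]
    intro j
    refine ((hfd j).continuous.div_const _).continuousAt.eventually_mem ?_
    rw [div_self (hne j)]
    exact isOpen_slitPlane.mem_nhds one_mem_slitPlane
  have hlog : ∀ s, (∀ j, f s j / f s₀ j ∈ slitPlane) →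
      IsLogTuple (lineAt x₀ x₁ s) (lineAt y₀ y₁ s) (L s) := by
    intro s hs j
    simp only [hL]
    rw [Complex.exp_add, Complex.exp_log (slitPlane_ne_zero (hs j)), hl j]
    exact mul_div_cancel₀ _ (hne j)
  have hLd : ∀ s, (∀ j, f s j / f s₀ j ∈ slitPlane) → ∀ j,
      DifferentiableAt ℂ (fun s => L s j) s := fun s hs j =>
    (((hfd j).div_const _).differentiableAt.clog (hs j)).const_add _
  choose r N hNo hN hr hrd using fun i => exists_local_primitive (w₀ := flat l i)
  have hLc : ∀ j, ContinuousAt (fun s => L s j) s₀ := fun j =>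
    (hLd s₀ hev.self_of_nhds j).continuousAt
  have hflatc : ∀ i, ContinuousAt (fun s => (flat (L s) i).1) s₀ := by
    intro i
    have := hLc
    fin_cases i <;> simp only [flat, Fin.zero_eta, Fin.mk_one, Fin.reduceFinMk, Matrix.cons_val] <;>
      fun_prop
  have hevN : ∀ᶠ s in nhds s₀, ∀ i, Complex.exp (flat (L s) i).1 ∈ N i := by
    rw [Filter.eventually_all]
    intro i
    refine (hflatc i).cexp.eventually_mem ((hNo i).mem_nhds ?_)
    rw [hL0]
    exact hN i
  obtain ⟨ε, hε, hball⟩ := Metric.eventually_nhds_iff_ball.1 (hev.and hevN)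
  set S : ℂ → ℂ := fun s => r 0 (flat (L s) 0) - r 1 (flat (L s) 1) + r 2 (flat (L s) 2) -
    r 3 (flat (L s) 3) + r 4 (flat (L s) 4) with hS
  have hSd : ∀ s ∈ Metric.ball s₀ ε, HasDerivAt S 0 s := by
    intro s hs
    have hX : ∀ i, ∀ᶠ t in nhds s, ((flat (L t) i).1, (flat (L t) i).2) ∈ EvenSheet := by
      intro i
      filter_upwards [Metric.isOpen_ball.mem_nhds hs] with t ht
      exact flat_mem_evenSheet (hlog t (hball t ht).1) i
    have hD : ∀ j, HasDerivAt (fun s => L s j) (deriv (fun s => L s j) s) s :=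
      fun j => (hLd s (hball s hs).1 j).hasDerivAt
    have hD0 := hD 0
    have hD1 := hD 1
    have hD2 := hD 2
    have hD3 := hD 3
    have hD4 := hD 4
    generalize deriv (fun s => L s 0) s = d0 at hD0
    generalize deriv (fun s => L s 1) s = d1 at hD1
    generalize deriv (fun s => L s 2) s = d2 at hD2
    generalize deriv (fun s => L s 3) s = d3 at hD3
    generalize deriv (fun s => L s 4) s = d4 at hD4
    have hNs := (hball s hs).2
    have r0 := hrd 0 _ _ _ _ s hD0 hD1.neg (hX 0) (hNs 0)
    have r1 := hrd 1 _ _ _ _ s hD2 hD3.neg (hX 1) (hNs 1)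
    have r2 := hrd 2 _ _ _ _ s (hD2.sub hD0) (hD0.sub hD4) (hX 2) (hNs 2)
    have r3 := hrd 3 _ _ _ _ s (((hD2.sub hD0).add hD1).sub hD3) ((hD0.sub hD4).add hD3)
      (hX 3) (hNs 3)
    have r4 := hrd 4 _ _ _ _ s (hD1.sub hD3) (hD3.sub hD4) (hX 4) (hNs 4)
    refine ((((r0.sub r1).add r2).sub r3).add r4).congr_deriv ?_
    simp only [Pi.add_apply, Pi.sub_apply, Pi.neg_apply]
    ring
  have hconst : ∀ s ∈ Metric.ball s₀ ε, S s = S s₀ := by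
    intro s hs
    exact Metric.isOpen_ball.is_const_of_deriv_eq_zero (𝕜 := ℂ)
      (convex_ball s₀ ε).isPreconnected
      (fun z hz => (hSd z hz).differentiableAt.differentiableWithinAt)
      (fun z hz => (hSd z hz).deriv) hs (Metric.mem_ball_self hε)
  have hsum : ∀ s ∈ Metric.ball s₀ ε, rogersSum (L s) = QuotientAddGroup.mk (S s) := by
    intro s hs
    have h := fun i => hr i _ (flat_mem_evenSheet (hlog s (hball s hs).1) i) ((hball s hs).2 i)
    simp only [rogersSum, Fin.sum_univ_five, h, hS, QuotientAddGroup.mk_add,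
      QuotientAddGroup.mk_sub]
    simp
    abel
  filter_upwards [Metric.ball_mem_nhds s₀ hε] with s hs
  rw [hsum s hs, hconst s hs, ← hsum s₀ (Metric.mem_ball_self hε), hL0]

lemma exists_lift_exp (γ : C(unitInterval, ℂ)) (h : ∀ t, γ t ≠ 0) {a : ℂ}
    (ha : Complex.exp a = γ 0) : ∃ Γ : C(unitInterval, ℂ), (∀ t, Complex.exp (Γ t) = γ t) ∧
      Γ 0 = a := by
  obtain ⟨Γ, h1, h2⟩ := Complex.isCoveringMap_exp.exists_path_lifts
    ⟨fun t => (⟨γ t, h t⟩ : {z : ℂ // z ≠ 0}), by fun_prop⟩ a (Subtype.ext ha.symm)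
  exact ⟨Γ, fun t => congrArg Subtype.val (congrFun h1 t), h2⟩

lemma eventually_eq_add_log {X : Type*} [TopologicalSpace X] {Γ : X → ℂ} {t₀ : X}
    (h : ContinuousAt Γ t₀) :
    ∀ᶠ t in nhds t₀, Γ t = Γ t₀ + Complex.log (Complex.exp (Γ t) / Complex.exp (Γ t₀)) := by
  have hc : ContinuousAt (fun t => (Γ t - Γ t₀).im) t₀ := by fun_prop
  have h0 : (Γ t₀ - Γ t₀).im ∈ Set.Ioo (-Real.pi) Real.pi := by
    simp [Real.pi_pos]
  filter_upwards [hc.eventually_mem (isOpen_Ioo.mem_nhds h0)] with t ht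
  rw [← Complex.exp_sub, Complex.log_exp ht.1 ht.2.le, add_sub_cancel]

lemma Valid.exists_path {x₀ y₀ x₁ y₁ : ℂ} (h₀ : Valid x₀ y₀) (h₁ : Valid x₁ y₁) :
    ∃ σ : C(unitInterval, ℂ), σ 0 = 0 ∧ σ 1 = 1 ∧
      ∀ t, Valid (lineAt x₀ x₁ (σ t)) (lineAt y₀ y₁ (σ t)) := by
  have key : ∀ a b c : ℂ, a ≠ c → {s : ℂ | lineAt a b s = c}.Subsingleton := by
    intro a b c hac s hs t ht
    simp only [lineAt, Set.mem_ofPred_eq] at hs ht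
    have hab : b - a ≠ 0 := by
      intro h
      rw [h, mul_zero, add_zero] at hs
      exact hac hs
    exact mul_right_cancel₀ hab (by linear_combination hs - ht)
  have hbad : {s : ℂ | ¬ Valid (lineAt x₀ x₁ s) (lineAt y₀ y₁ s)}.Countable := by
    have hsub : {s : ℂ | ¬ Valid (lineAt x₀ x₁ s) (lineAt y₀ y₁ s)} ⊆
        {s | lineAt x₀ x₁ s = 0} ∪ {s | lineAt x₀ x₁ s = 1} ∪ {s | lineAt y₀ y₁ s = 0} ∪
        {s | lineAt y₀ y₁ s = 1} ∪ {s | lineAt (x₀ - y₀) (x₁ - y₁) s = 0} := by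
      intro s hs
      have e : lineAt (x₀ - y₀) (x₁ - y₁) s = lineAt x₀ x₁ s - lineAt y₀ y₁ s := by
        simp only [lineAt]; ring
      simp only [Set.mem_union, Set.mem_ofPred_eq, e, sub_eq_zero]
      simp only [Valid, Reg, Set.mem_ofPred_eq] at hs
      tauto
    refine Set.Countable.mono hsub ?_
    exact ((((key _ _ _ h₀.1.1).countable.union (key _ _ _ h₀.1.2).countable).union
      (key _ _ _ h₀.2.1.1).countable).union (key _ _ _ h₀.2.1.2).countable).union
      (key _ _ _ (sub_ne_zero.2 h₀.2.2)).countable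
  have hpc := Set.Countable.isPathConnected_compl_of_one_lt_rank
    (by rw [Complex.rank_real_complex]; norm_num) hbad
  have hj := hpc.joinedIn 0 (by simpa [lineAt] using h₀) 1 (by simpa [lineAt] using h₁)
  refine ⟨hj.somePath, hj.somePath.source, hj.somePath.target, fun t => ?_⟩
  exact not_not.1 (hj.somePath_mem t)

/-- The flattened points over `FT` with all signs positive, in logarithmic coordinates. -/
def LogTuples : Set (Fin 5 → ℂ) := {l | ∃ x y, IsLogTuple x y l}

/-- Paths in `FT` lift to logarithmic coordinates, and the Rogers sum is constant along them. -/
lemma exists_joinedIn_logTuples {x₀ y₀ x₁ y₁ : ℂ} {l₀ : Fin 5 → ℂ} (h₀ : IsLogTuple x₀ y₀ l₀)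
    (h₁ : Valid x₁ y₁) : ∃ l₁, IsLogTuple x₁ y₁ l₁ ∧ JoinedIn LogTuples l₀ l₁ ∧
      rogersSum l₁ = rogersSum l₀ := by
  obtain ⟨σ, hσ0, hσ1, hσ⟩ := h₀.valid.exists_path h₁
  have hcont : ∀ j, Continuous fun t =>
      logArgs (lineAt x₀ x₁ (σ t)) (lineAt y₀ y₁ (σ t)) j := by
    intro j
    have := σ.continuous
    fin_cases j <;> simp only [logArgs, lineAt, Fin.zero_eta, Fin.mk_one, Fin.reduceFinMk,
      Matrix.cons_val] <;> fun_prop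
  choose Γ hΓ hΓ0 using fun j => exists_lift_exp
    ⟨fun t => logArgs (lineAt x₀ x₁ (σ t)) (lineAt y₀ y₁ (σ t)) j, hcont j⟩
    (fun t => (hσ t).logArgs_ne_zero j) (a := l₀ j) (by simpa [hσ0, lineAt] using h₀ j)
  have hlog : ∀ t, IsLogTuple (lineAt x₀ x₁ (σ t)) (lineAt y₀ y₁ (σ t)) fun j => Γ j t :=
    fun t j => hΓ j t
  have hΓ0' : (fun j => Γ j 0) = l₀ := funext hΓ0
  have hpath : JoinedIn LogTuples l₀ (fun j => Γ j 1) :=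
    ⟨⟨⟨fun t j => Γ j t, by fun_prop⟩, hΓ0', rfl⟩, fun t => ⟨_, _, hlog t⟩⟩
  refine ⟨fun j => Γ j 1, by simpa [hσ1, lineAt] using hlog 1, hpath, ?_⟩
  have hloc : IsLocallyConstant fun t : unitInterval => rogersSum fun j => Γ j t := by
    rw [IsLocallyConstant.iff_eventually_eq]
    intro t₀
    have h1 := σ.continuous.continuousAt.eventually (rogersSum_locally_constant (hlog t₀))
    have h2 : ∀ᶠ t in nhds t₀, ∀ j, Γ j t = Γ j t₀ +
        Complex.log (Complex.exp (Γ j t) / Complex.exp (Γ j t₀)) := by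
      rw [Filter.eventually_all]
      exact fun j => eventually_eq_add_log (Γ j).continuous.continuousAt
    filter_upwards [h1, h2] with t ht1 ht2
    rw [← ht1]
    congr 1
    funext j
    rw [ht2 j, hΓ, hΓ]
    rfl
  rw [← hΓ0']
  exact hloc.apply_eq_of_isPreconnected isPreconnected_univ (Set.mem_univ _) (Set.mem_univ _)

/-- Principal logarithms at the base point of the five term cover. -/
def baseLog : Fin 5 → ℂ := fun j => Complex.log (logArgs ((1 + I) / 4) I j)

lemma valid_base : Valid ((1 + I) / 4) I := by
  refine ⟨⟨?_, ?_⟩, ⟨I_ne_zero, ?_⟩, ?_⟩ <;> intro h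
  · simpa using congrArg Complex.re h
  · have := congrArg Complex.im h
    norm_num at this
  · simpa using congrArg Complex.re h
  · have := congrArg Complex.re h
    norm_num at this

lemma isLogTuple_baseLog : IsLogTuple ((1 + I) / 4) I baseLog :=
  fun j => Complex.exp_log (valid_base.logArgs_ne_zero j)

lemma flat_baseLog : flat baseLog = basePt := by
  have h0 : 0 < (baseLog 0).im ∧ |(baseLog 0).im| < Real.pi / 2 := by
    simp only [baseLog, log_im, logArgs, Matrix.cons_val]
    refine ⟨lt_of_le_of_ne (arg_nonneg_iff.2 (by norm_num)) (fun h => ?_),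
      abs_arg_lt_pi_div_two_iff.2 (Or.inl (by norm_num))⟩
    have := (arg_eq_zero_iff.1 h.symm).2
    norm_num at this
  have h1 : (baseLog 1).im < 0 ∧ |(baseLog 1).im| < Real.pi / 2 := by
    simp only [baseLog, log_im, logArgs, Matrix.cons_val]
    exact ⟨arg_neg_iff.2 (by norm_num), abs_arg_lt_pi_div_two_iff.2 (Or.inl (by norm_num))⟩
  have h2 : (baseLog 2).im = Real.pi / 2 := by
    simp only [baseLog, log_im, logArgs, Matrix.cons_val, arg_I]
  have h3 : (baseLog 3).im < 0 ∧ |(baseLog 3).im| < Real.pi / 2 := by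
    simp only [baseLog, log_im, logArgs, Matrix.cons_val]
    exact ⟨arg_neg_iff.2 (by norm_num), abs_arg_lt_pi_div_two_iff.2 (Or.inl (by norm_num))⟩
  have h4 : (baseLog 4).im < 0 ∧ |(baseLog 4).im| < Real.pi / 2 := by
    simp only [baseLog, log_im, logArgs, Matrix.cons_val]
    exact ⟨arg_neg_iff.2 (by norm_num), abs_arg_lt_pi_div_two_iff.2 (Or.inl (by norm_num))⟩
  rw [abs_lt] at h0 h1 h3 h4
  obtain ⟨a0, a0', a0''⟩ := h0
  obtain ⟨a1, a1', a1''⟩ := h1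
  obtain ⟨a3, a3', a3''⟩ := h3
  obtain ⟨a4, a4', a4''⟩ := h4
  have hpi := Real.pi_pos
  have key : ∀ i, (-Real.pi < (flat baseLog i).1.im ∧ (flat baseLog i).1.im ≤ Real.pi) ∧
      (-Real.pi < (-(flat baseLog i).2).im ∧ (-(flat baseLog i).2).im ≤ Real.pi) := by
    intro i
    fin_cases i <;>
      simp only [flat, Fin.zero_eta, Fin.mk_one, Fin.reduceFinMk, Matrix.cons_val, sub_im, add_im,
        neg_im] <;>
      refine ⟨⟨?_, ?_⟩, ?_, ?_⟩ <;> linarith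
  funext i
  obtain ⟨e1, e2⟩ := exp_flat isLogTuple_baseLog i
  obtain ⟨⟨k1, k2⟩, k3, k4⟩ := key i
  simp only [basePt, pt, ← e1]
  rw [e1, ← e2, ← e1, Complex.log_exp k1 k2, Complex.log_exp k3 k4]
  simp

/-- The linear relations satisfied by the flattenings of a five term tuple. -/
def LinRel (w : Fin 5 → ℂ × ℂ) : Prop :=
  (w 2).1 = (w 1).1 - (w 0).1 ∧ (w 3).1 = (w 1).1 - (w 0).1 + (w 1).2 - (w 0).2 ∧
  (w 4).1 = (w 1).2 - (w 0).2 ∧ (w 3).2 = (w 2).2 - (w 1).2 ∧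
  (w 4).2 = (w 2).2 - (w 1).2 - (w 0).1

lemma linRel_flat (l : Fin 5 → ℂ) : LinRel (flat l) := by
  simp only [LinRel, flat, Matrix.cons_val]
  refine ⟨trivial, ?_, ?_, ?_, ?_⟩ <;> ring

lemma covAct_pt (z : ℂ) (p q p' q' : ℤ) : covAct (p', q') (pt z p q) = pt z (p + p') (q + q') := by
  simp only [covAct, pt]
  push_cast
  ext <;> simp <;> ring

lemma exists_eq_covAct_flat {x y : ℂ} {l : Fin 5 → ℂ} (hl : IsLogTuple x y l)
    {w : Fin 5 → ℂ × ℂ} (hw : ∀ i, LiesOver (w i) (ftTuple x y i)) :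
    ∃ p q : Fin 5 → ℤ, ∀ i, w i = covAct (p i, q i) (flat l i) := by
  choose _ P Q hPQ using hw
  choose k m hkm using fun i => (flat_eq_pt hl i).2
  refine ⟨fun i => P i - 2 * k i, fun i => Q i - 2 * m i, fun i => ?_⟩
  rw [hPQ, hkm, covAct_pt]
  congr 1 <;> ring

lemma exists_mem_Vset {x y : ℂ} {l : Fin 5 → ℂ} (hl : IsLogTuple x y l)
    {w : Fin 5 → ℂ × ℂ} (hw : ∀ i, LiesOver (w i) (ftTuple x y i)) (hr : LinRel w) :
    ∃ v ∈ Vset, w = fun i => covAct (v i) (flat l i) := by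
  obtain ⟨p, q, h⟩ := exists_eq_covAct_flat hl hw
  have hc : Cpi * I ≠ 0 := mul_ne_zero Cpi_ne_zero I_ne_zero
  obtain ⟨f1, f2, f3, f4, f5⟩ := linRel_flat l
  obtain ⟨r1, r2, r3, r4, r5⟩ := hr
  simp only [h, covAct] at r1 r2 r3 r4 r5
  have e1 : p 2 = p 1 - p 0 := by
    have : (p 2 : ℂ) = p 1 - p 0 := mul_right_cancel₀ hc (by linear_combination r1 - f1)
    exact_mod_cast this
  have e2 : p 3 = p 1 - p 0 + q 1 - q 0 := by
    have : (p 3 : ℂ) = p 1 - p 0 + q 1 - q 0 :=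
      mul_right_cancel₀ hc (by linear_combination r2 - f2)
    exact_mod_cast this
  have e3 : p 4 = q 1 - q 0 := by
    have : (p 4 : ℂ) = q 1 - q 0 := mul_right_cancel₀ hc (by linear_combination r3 - f3)
    exact_mod_cast this
  have e4 : q 3 = q 2 - q 1 := by
    have : (q 3 : ℂ) = q 2 - q 1 := mul_right_cancel₀ hc (by linear_combination r4 - f4)
    exact_mod_cast this
  have e5 : q 4 = q 2 - q 1 - p 0 := by
    have : (q 4 : ℂ) = q 2 - q 1 - p 0 := mul_right_cancel₀ hc (by linear_combination r5 - f5)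
    exact_mod_cast this
  refine ⟨fun i => (p i, q i), ⟨p 0, p 1, q 0, q 1, q 2, ?_⟩, funext h⟩
  funext i
  fin_cases i <;> simp [e1, e2, e3, e4, e5]

lemma liesOver_flat {x y : ℂ} {l : Fin 5 → ℂ} (hl : IsLogTuple x y l) (i : Fin 5) :
    LiesOver (flat l i) (ftTuple x y i) :=
  let ⟨h, _, _, e⟩ := flat_eq_pt hl i
  ⟨h, _, _, e⟩

lemma flat_mem_FTpre {l : Fin 5 → ℂ} (hl : l ∈ LogTuples) : flat l ∈ FTpre :=
  let ⟨x, y, h⟩ := hl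
  ⟨ftTuple x y, ⟨x, y, h.valid.1, h.valid.2.1, h.valid.2.2, rfl⟩, liesOver_flat h⟩

lemma continuous_flat : Continuous flat := by
  refine continuous_pi fun i => ?_
  fin_cases i <;> simp only [flat, Fin.zero_eta, Fin.mk_one, Fin.reduceFinMk, Matrix.cons_val] <;>
    fun_prop

lemma flat_mem_FThat₀ {l : Fin 5 → ℂ} (h : JoinedIn LogTuples baseLog l) : flat l ∈ FThat₀ := by
  have hp : IsPreconnected (flat '' Set.range h.somePath) :=
    (isPreconnected_range h.somePath.continuous).image _ continuous_flat.continuousOn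
  refine hp.subset_connectedComponentIn ⟨baseLog, ⟨0, h.somePath.source⟩, flat_baseLog⟩ ?_
    ⟨l, ⟨1, h.somePath.target⟩, rfl⟩
  rintro _ ⟨_, ⟨t, rfl⟩, rfl⟩
  exact flat_mem_FTpre (h.somePath_mem t)

lemma eq_of_isPreconnected_of_int_valued {S : Set (Fin 5 → ℂ × ℂ)} (hS : IsPreconnected S)
    {D : (Fin 5 → ℂ × ℂ) → ℂ} (hD : Continuous D)
    (hint : ∀ w ∈ S, ∃ n : ℤ, D w = n * (Cpi * I)) {a b : Fin 5 → ℂ × ℂ} (ha : a ∈ S)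
    (hb : b ∈ S) : D a = D b := by
  have hT : (D '' S).Countable := by
    refine (Set.countable_range fun n : ℤ => (n : ℂ) * (Cpi * I)).mono ?_
    rintro _ ⟨w, hw, rfl⟩
    obtain ⟨n, hn⟩ := hint w hw
    exact ⟨n, hn.symm⟩
  exact hT.isTotallyDisconnected _ subset_rfl (hS.image _ hD.continuousOn)
    (Set.mem_image_of_mem D ha) (Set.mem_image_of_mem D hb)

lemma linRel_of_mem_FThat₀ {w : Fin 5 → ℂ × ℂ} (hw : w ∈ FThat₀) : LinRel w := by
  have hbase : basePt ∈ FTpre := flat_baseLog ▸ flat_mem_FTpre ⟨_, _, isLogTuple_baseLog⟩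
  have hb : basePt ∈ FThat₀ := mem_connectedComponentIn hbase
  have hpre : IsPreconnected FThat₀ := isPreconnected_connectedComponentIn
  have hrb : LinRel basePt := flat_baseLog ▸ linRel_flat _
  have hshift : ∀ u ∈ FThat₀, ∃ l, ∃ p q : Fin 5 → ℤ, ∀ i, u i = covAct (p i, q i) (flat l i) := by
    intro u hu
    obtain ⟨_, ⟨x, y, hx, hy, hxy, rfl⟩, hover⟩ := connectedComponentIn_subset _ _ hu
    obtain ⟨l, hl⟩ := Valid.exists_isLogTuple ⟨hx, hy, hxy⟩
    exact ⟨l, exists_eq_covAct_flat hl hover⟩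
  obtain ⟨b1, b2, b3, b4, b5⟩ := hrb
  refine ⟨?_, ?_, ?_, ?_, ?_⟩
  · have h := eq_of_isPreconnected_of_int_valued hpre
      (D := fun w => (w 2).1 - ((w 1).1 - (w 0).1)) (by fun_prop) (fun u hu => ?_) hw hb
    · simp only [b1, sub_self] at h
      exact sub_eq_zero.1 h
    · obtain ⟨l, p, q, e⟩ := hshift u hu
      obtain ⟨f1, f2, f3, f4, f5⟩ := linRel_flat l
      refine ⟨p 2 - (p 1 - p 0), ?_⟩
      simp only [e, covAct]
      push_cast
      linear_combination f1
  · have h := eq_of_isPreconnected_of_int_valued hpre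
      (D := fun w => (w 3).1 - ((w 1).1 - (w 0).1 + (w 1).2 - (w 0).2)) (by fun_prop)
      (fun u hu => ?_) hw hb
    · simp only [b2, sub_self] at h
      exact sub_eq_zero.1 h
    · obtain ⟨l, p, q, e⟩ := hshift u hu
      obtain ⟨f1, f2, f3, f4, f5⟩ := linRel_flat l
      refine ⟨p 3 - (p 1 - p 0 + q 1 - q 0), ?_⟩
      simp only [e, covAct]
      push_cast
      linear_combination f2
  · have h := eq_of_isPreconnected_of_int_valued hpre
      (D := fun w => (w 4).1 - ((w 1).2 - (w 0).2)) (by fun_prop) (fun u hu => ?_) hw hb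
    · simp only [b3, sub_self] at h
      exact sub_eq_zero.1 h
    · obtain ⟨l, p, q, e⟩ := hshift u hu
      obtain ⟨f1, f2, f3, f4, f5⟩ := linRel_flat l
      refine ⟨p 4 - (q 1 - q 0), ?_⟩
      simp only [e, covAct]
      push_cast
      linear_combination f3
  · have h := eq_of_isPreconnected_of_int_valued hpre
      (D := fun w => (w 3).2 - ((w 2).2 - (w 1).2)) (by fun_prop) (fun u hu => ?_) hw hb
    · simp only [b4, sub_self] at h
      exact sub_eq_zero.1 h
    · obtain ⟨l, p, q, e⟩ := hshift u hu
      obtain ⟨f1, f2, f3, f4, f5⟩ := linRel_flat l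
      refine ⟨q 3 - (q 2 - q 1), ?_⟩
      simp only [e, covAct]
      push_cast
      linear_combination f4
  · have h := eq_of_isPreconnected_of_int_valued hpre
      (D := fun w => (w 4).2 - ((w 2).2 - (w 1).2 - (w 0).1)) (by fun_prop)
      (fun u hu => ?_) hw hb
    · simp only [b5, sub_self] at h
      exact sub_eq_zero.1 h
    · obtain ⟨l, p, q, e⟩ := hshift u hu
      obtain ⟨f1, f2, f3, f4, f5⟩ := linRel_flat l
      refine ⟨q 4 - (q 2 - q 1 - p 0), ?_⟩
      simp only [e, covAct]
      push_cast
      linear_combination f5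

/-- Every point of the lifted five term set is a translate by `V` of a flattening. -/
lemma exists_of_mem_FThat {w : Fin 5 → ℂ × ℂ} (hw : w ∈ FThat) :
    ∃ x y l, IsLogTuple x y l ∧ rogersSum l = rogersSum baseLog ∧
      ∃ p₀ p₁ q₀ q₁ q₂ : ℤ, w = fun i => covAct (![(p₀, q₀), (p₁, q₁), (p₁ - p₀, q₂),
        (p₁ - p₀ + q₁ - q₀, q₂ - q₁), (q₁ - q₀, q₂ - q₁ - p₀)] i) (flat l i) := by
  obtain ⟨u, hu, _, ⟨p₀, p₁, q₀, q₁, q₂, rfl⟩, rfl⟩ := hw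
  obtain ⟨_, ⟨x, y, hx, hy, hxy, rfl⟩, hover⟩ := connectedComponentIn_subset _ _ hu
  obtain ⟨l, hl, -, hsum⟩ := exists_joinedIn_logTuples isLogTuple_baseLog
    (x₁ := x) (y₁ := y) ⟨hx, hy, hxy⟩
  obtain ⟨_, ⟨p₀', p₁', q₀', q₁', q₂', rfl⟩, rfl⟩ :=
    exists_mem_Vset hl hover (linRel_of_mem_FThat₀ hu)
  refine ⟨x, y, l, hl, hsum, p₀ + p₀', p₁ + p₁', q₀ + q₀', q₁ + q₁', q₂ + q₂', ?_⟩
  funext i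
  fin_cases i <;> simp [covAct] <;> constructor <;> ring

lemma exists_lift_mem_FThat {x y : ℂ} (h : Valid x y) : ∃ P Q : Fin 5 → ℤ,
    ∀ p₀ p₁ q₀ q₁ q₂ : ℤ, (fun i => covAct (![(p₀, q₀), (p₁, q₁), (p₁ - p₀, q₂),
        (p₁ - p₀ + q₁ - q₀, q₂ - q₁), (q₁ - q₀, q₂ - q₁ - p₀)] i)
          (pt (ftTuple x y i) (P i) (Q i))) ∈ FThat := by
  obtain ⟨l, hl, hj, -⟩ := exists_joinedIn_logTuples isLogTuple_baseLog h
  choose k m hkm using fun i => (flat_eq_pt hl i).2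
  refine ⟨fun i => 2 * k i, fun i => 2 * m i, fun p₀ p₁ q₀ q₁ q₂ => ?_⟩
  refine ⟨flat l, flat_mem_FThat₀ hj, _, ⟨p₀, p₁, q₀, q₁, q₂, rfl⟩, ?_⟩
  simp only [hkm]

/-- A symbol on `𝓒` satisfying the transfer and the lifted five term relations, the latter up to
an unspecified choice of lifts of each five term tuple. -/
structure IsExtendedSymbol {A : Type*} [AddCommGroup A] (c : ℂ → ℤ → ℤ → A) : Prop where
  transfer : ∀ z, Reg z → ∀ p q p' q' : ℤ, c z p q + c z p' q' = c z p q' + c z p' q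
  five : ∀ x y, Valid x y → ∃ a b d e f : ℤ, ∀ p₀ p₁ p₂ p₃ p₄ q₀ q₁ q₂ q₃ q₄ : ℤ,
    p₂ = p₁ - p₀ + a → p₃ = p₁ - p₀ + q₁ - q₀ + b → p₄ = q₁ - q₀ + d → q₃ = q₂ - q₁ + e →
    q₄ = q₂ - q₁ - p₀ + f →
    c x p₀ q₀ - c y p₁ q₁ + c (y / x) p₂ q₂ - c ((1 - x⁻¹) / (1 - y⁻¹)) p₃ q₃ +
      c ((1 - x) / (1 - y)) p₄ q₄ = 0

lemma exists_reg_ne (a b : ℂ) : ∃ z, Reg z ∧ z ≠ a ∧ z ≠ b := by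
  obtain ⟨z, hz⟩ := Infinite.exists_notMem_finset ({0, 1, a, b} : Finset ℂ)
  simp only [Finset.mem_insert, Finset.mem_singleton, not_or] at hz
  exact ⟨z, ⟨hz.1, hz.2.1⟩, hz.2.2⟩

namespace IsExtendedSymbol

variable {A : Type*} [AddCommGroup A] {c : ℂ → ℤ → ℤ → A}

lemma sub_left (h : IsExtendedSymbol c) {z : ℂ} (hz : Reg z) (p q q' : ℤ) :
    c z p q - c z p q' = c z 0 q - c z 0 q' := by
  rw [sub_eq_sub_iff_add_eq_add, h.transfer z hz, add_comm]

lemma sub_right (h : IsExtendedSymbol c) {z : ℂ} (hz : Reg z) (p p' q : ℤ) :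
    c z p q - c z p' q = c z p 0 - c z p' 0 := by
  rw [sub_eq_sub_iff_add_eq_add, h.transfer z hz, add_comm]

lemma delta_ftTuple (h : IsExtendedSymbol c) {x y : ℂ} (hxy : Valid x y) (i j k : ℤ) :
    (c (y / x) 0 (i + 1) - c (y / x) 0 i) -
      (c ((1 - x⁻¹) / (1 - y⁻¹)) 0 (j + 1) - c ((1 - x⁻¹) / (1 - y⁻¹)) 0 j) +
      (c ((1 - x) / (1 - y)) 0 (k + 1) - c ((1 - x) / (1 - y)) 0 k) = 0 := by
  obtain ⟨a, b, d, e, f, H⟩ := h.five x y hxy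
  have h1 := H (i - (i - j + e) - k + f) 0 _ _ _ 0 (i - j + e) (i + 1) (j + 1) (k + 1) rfl rfl rfl
    (by ring) (by ring)
  have h0 := H (i - (i - j + e) - k + f) 0 _ _ _ 0 (i - j + e) i j k rfl rfl rfl
    (by ring) (by ring)
  have r2 : Reg (y / x) := hxy.reg_ftTuple 2
  have r3 : Reg ((1 - x⁻¹) / (1 - y⁻¹)) := hxy.reg_ftTuple 3
  have r4 : Reg ((1 - x) / (1 - y)) := hxy.reg_ftTuple 4
  rw [← h.sub_left r2, ← h.sub_left r3, ← h.sub_left r4]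
  rw [← sub_zero (0 : A)]
  conv_rhs => congr; rw [← h1]
  conv_rhs => rw [← h0]
  abel

lemma delta_mul_aux (h : IsExtendedSymbol c) {a b : ℂ} (ha : Reg a) (hb : Reg b) (hab : a * b ≠ 1)
    (i j k : ℤ) : (c a 0 (i + 1) - c a 0 i) - (c (a * b) 0 (j + 1) - c (a * b) 0 j) +
      (c b 0 (k + 1) - c b 0 k) = 0 := by
  obtain ⟨a0, a1⟩ := ha
  obtain ⟨b0, b1⟩ := hb
  have a1' : a - 1 ≠ 0 := sub_ne_zero.2 a1
  have b1' : b - 1 ≠ 0 := sub_ne_zero.2 b1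
  have c1' : a * b - 1 ≠ 0 := sub_ne_zero.2 hab
  have ex : 1 - (b - 1) / (a * b - 1) = b * (a - 1) / (a * b - 1) := by
    rw [eq_div_iff c1', sub_mul, div_mul_cancel₀ _ c1']; ring
  have ey : 1 - a * (b - 1) / (a * b - 1) = (a - 1) / (a * b - 1) := by
    rw [eq_div_iff c1', sub_mul, div_mul_cancel₀ _ c1']; ring
  have hx : (b - 1) / (a * b - 1) ≠ 0 := div_ne_zero b1' c1'
  have hy : a * (b - 1) / (a * b - 1) ≠ 0 := div_ne_zero (mul_ne_zero a0 b1') c1'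
  have hx1 : 1 - (b - 1) / (a * b - 1) ≠ 0 := ex ▸ div_ne_zero (mul_ne_zero b0 a1') c1'
  have hy1 : 1 - a * (b - 1) / (a * b - 1) ≠ 0 := ey ▸ div_ne_zero a1' c1'
  have e2 : a * (b - 1) / (a * b - 1) / ((b - 1) / (a * b - 1)) = a := by field_simp
  have e4 : (1 - (b - 1) / (a * b - 1)) / (1 - a * (b - 1) / (a * b - 1)) = b := by
    rw [ex, ey, div_div_div_cancel_right₀ c1', mul_div_cancel_right₀ _ a1']
  have e3 : (1 - ((b - 1) / (a * b - 1))⁻¹) / (1 - (a * (b - 1) / (a * b - 1))⁻¹) = a * b := by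
    have : ∀ x y : ℂ, x ≠ 0 → y ≠ 0 → (1 - x⁻¹) / (1 - y⁻¹) = (y / x) * ((1 - x) / (1 - y)) := by
      intro x y h0 h0'
      have u : 1 - x⁻¹ = -(1 - x) / x := by field_simp; ring
      have v : 1 - y⁻¹ = -(1 - y) / y := by field_simp; ring
      rw [u, v, div_div_div_eq, div_mul_div_comm, neg_mul, mul_neg, neg_div_neg_eq]
      ring
    rw [this _ _ hx hy, e2, e4]
  have hv : Valid ((b - 1) / (a * b - 1)) (a * (b - 1) / (a * b - 1)) := by
    refine ⟨⟨hx, fun e => hx1 (by rw [e, sub_self])⟩, ⟨hy, fun e => hy1 (by rw [e, sub_self])⟩,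
      fun e => a1 ?_⟩
    rw [← e2, ← e, div_self hx]
  have := h.delta_ftTuple hv i j k
  rwa [e2, e3, e4] at this

lemma delta_eq (h : IsExtendedSymbol c) {a : ℂ} (ha : Reg a) (i : ℤ) :
    c a 0 (i + 1) - c a 0 i = c a 0 1 - c a 0 0 := by
  obtain ⟨b, hb, hb1, -⟩ := exists_reg_ne a⁻¹ 0
  have hab : a * b ≠ 1 := fun e => hb1 (eq_inv_of_mul_eq_one_right e)
  have h1 := h.delta_mul_aux ha hb hab i 0 0
  rw [← h.delta_mul_aux ha hb hab 0 0 0, zero_add] at h1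
  exact sub_left_injective (add_left_injective _ h1)

lemma delta_mul (h : IsExtendedSymbol c) {a b : ℂ} (ha : Reg a) (hb : Reg b) (hab : a * b ≠ 1) :
    c (a * b) 0 1 - c (a * b) 0 0 = (c a 0 1 - c a 0 0) + (c b 0 1 - c b 0 0) := by
  have := h.delta_mul_aux ha hb hab 0 0 0
  rw [zero_add, sub_add_eq_add_sub, sub_eq_zero] at this
  exact this.symm

lemma delta_add_inv (h : IsExtendedSymbol c) {a : ℂ} (ha : Reg a) :
    (c a 0 1 - c a 0 0) + (c a⁻¹ 0 1 - c a⁻¹ 0 0) = 0 := by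
  obtain ⟨b, hb, hba, -⟩ := exists_reg_ne a 0
  have ha' : Reg a⁻¹ := ⟨inv_ne_zero ha.1, inv_ne_one.2 ha.2⟩
  have hab : a⁻¹ * b ≠ 1 := fun e => hba (by rw [← mul_one a, ← e, mul_inv_cancel_left₀ ha.1])
  have h1 := h.delta_mul ha' hb hab
  have hr : Reg (a⁻¹ * b) := ⟨mul_ne_zero ha'.1 hb.1, hab⟩
  have h2 := h.delta_mul ha hr (by rw [mul_inv_cancel_left₀ ha.1]; exact hb.2)
  rw [mul_inv_cancel_left₀ ha.1, h1, ← add_assoc] at h2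
  exact add_eq_right.1 h2.symm

/-- The homomorphism `z ↦ [z,0,1] - [z,0,0]` attached to an extended symbol. -/
def chi (h : IsExtendedSymbol c) : Additive ℂˣ →+ A :=
  AddMonoidHom.mk' (fun u => if (u.toMul : ℂ) = 1 then 0 else c u.toMul 0 1 - c u.toMul 0 0) <| by
    intro u v
    obtain ⟨u, rfl⟩ := Additive.ofMul.surjective u
    obtain ⟨v, rfl⟩ := Additive.ofMul.surjective v
    simp only [toMul_add, toMul_ofMul, Units.val_mul]
    by_cases hu : (u : ℂ) = 1
    · simp [hu]
    by_cases hv : (v : ℂ) = 1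
    · simp [hv]
    have ru : Reg u := ⟨u.ne_zero, hu⟩
    by_cases huv : (u : ℂ) * v = 1
    · have : (v : ℂ) = (u : ℂ)⁻¹ := eq_inv_of_mul_eq_one_right huv
      rw [if_pos huv, if_neg hu, if_neg hv, this, h.delta_add_inv ru]
    · rw [if_neg huv, if_neg hu, if_neg hv, h.delta_mul ru ⟨v.ne_zero, hv⟩ huv]

lemma chi_apply (h : IsExtendedSymbol c) {z : ℂ} (h0 : z ≠ 0) (h1 : z ≠ 1) :
    h.chi (Additive.ofMul (Units.mk0 z h0)) = c z 0 1 - c z 0 0 := by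
  exact if_neg h1

lemma delta_mem_range (h : IsExtendedSymbol c) {z : ℂ} (hz : Reg z) (i : ℤ) :
    c z 0 (i + 1) - c z 0 i ∈ h.chi.range :=
  ⟨_, (h.chi_apply hz.1 hz.2).trans (h.delta_eq hz i).symm⟩

lemma eps_ftTuple (h : IsExtendedSymbol c) {x y : ℂ} (hxy : Valid x y) (i j k : ℤ) :
    c y (i + 1) 0 - c y i 0 = (c (y / x) (j + 1) 0 - c (y / x) j 0) -
      (c ((1 - x⁻¹) / (1 - y⁻¹)) (k + 1) 0 - c ((1 - x⁻¹) / (1 - y⁻¹)) k 0) := by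
  obtain ⟨a, b, d, e, f, H⟩ := h.five x y hxy
  have h1 := H (i - j + a) (i + 1) (j + 1) (k + 1) _ 0 (k - j + a - b) 0 _ _ (by ring) (by ring)
    rfl rfl rfl
  have h0 := H (i - j + a) i j k _ 0 (k - j + a - b) 0 _ _ (by ring) (by ring) rfl rfl rfl
  have r1 : Reg y := hxy.2.1
  have r2 : Reg (y / x) := hxy.reg_ftTuple 2
  have r3 : Reg ((1 - x⁻¹) / (1 - y⁻¹)) := hxy.reg_ftTuple 3
  rw [← h.sub_right r1 _ _ (k - j + a - b), ← h.sub_right r2 _ _ 0,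
    ← h.sub_right r3 _ _ (0 - (k - j + a - b) + e), ← sub_eq_zero]
  rw [← sub_zero (0 : A)]
  conv_rhs => congr; rw [← h0]
  conv_rhs => rw [← h1]
  abel

lemma eps_sub_eps_mem_range (h : IsExtendedSymbol c) {x y : ℂ} (hxy : Valid x y) :
    (c x 1 0 - c x 0 0) - (c y 1 0 - c y 0 0) ∈ h.chi.range := by
  obtain ⟨a, b, d, e, f, H⟩ := h.five x y hxy
  have h1 := H 1 0 _ _ _ 0 0 0 _ (-1 + f) rfl rfl rfl rfl (by ring)
  have h0 := H 0 0 (0 - 1 + a + 1) (0 - 1 + 0 - 0 + b + 1) _ 0 0 0 _ (-1 + f + 1) (by ring)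
    (by ring) rfl rfl (by ring)
  have r0 : Reg x := hxy.1
  have r1 : Reg y := hxy.2.1
  have r2 : Reg (y / x) := hxy.reg_ftTuple 2
  have r3 : Reg ((1 - x⁻¹) / (1 - y⁻¹)) := hxy.reg_ftTuple 3
  have r4 : Reg ((1 - x) / (1 - y)) := hxy.reg_ftTuple 4
  have h2 := h.eps_ftTuple hxy 0 (0 - 1 + a) (0 - 1 + 0 - 0 + b)
  rw [zero_add] at h2
  convert h.delta_mem_range r4 (-1 + f) using 1
  rw [h2, ← h.sub_right r2 _ _ 0, ← h.sub_right r3 _ _ (0 - 0 + e),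
    ← h.sub_left r4 (0 - 0 + d), ← sub_eq_zero]
  rw [← sub_zero (0 : A)]
  conv_rhs => congr; rw [← h1]
  conv_rhs => rw [← h0]
  abel

lemma eps_mem_range (h : IsExtendedSymbol c) {y : ℂ} (hy : Reg y) (i : ℤ) :
    c y (i + 1) 0 - c y i 0 ∈ h.chi.range := by
  have hmem : ∀ u v, Reg u → Reg v →
      (c u 1 0 - c u 0 0) - (c v 1 0 - c v 0 0) ∈ h.chi.range := by
    intro u v hu hv
    by_cases huv : u = v
    · rw [huv, sub_self]
      exact zero_mem _
    · exact h.eps_sub_eps_mem_range ⟨hu, hv, huv⟩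
  obtain ⟨x, hx, hxy, -⟩ := exists_reg_ne y 0
  have hv : Valid x y := ⟨hx, hy, hxy⟩
  rw [h.eps_ftTuple hv i 0 0, zero_add]
  exact hmem _ _ (hv.reg_ftTuple 2) (hv.reg_ftTuple 3)

/-- Modulo the image of `chi`, an extended symbol depends only on the point of `ℂ ∖ {0,1}`. -/
lemma sub_mem_range (h : IsExtendedSymbol c) {z : ℂ} (hz : Reg z) (p q : ℤ) :
    c z p q - c z 0 0 ∈ h.chi.range := by
  have hq : ∀ q : ℤ, c z 0 q - c z 0 0 ∈ h.chi.range := by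
    intro q
    induction q with
    | zero => simp
    | succ n ih => simpa using add_mem (h.delta_mem_range hz n) ih
    | pred n ih => simpa using sub_mem ih (h.delta_mem_range hz (-n - 1))
  have hp : ∀ p : ℤ, c z p 0 - c z 0 0 ∈ h.chi.range := by
    intro p
    induction p with
    | zero => simp
    | succ n ih => simpa using add_mem (h.eps_mem_range hz n) ih
    | pred n ih => simpa using sub_mem ih (h.eps_mem_range hz (-n - 1))
  have := add_mem (hp p) (hq q)
  rwa [← h.sub_left hz p, sub_add_sub_comm, add_comm (c z p 0), ← sub_add_sub_comm, sub_add_sub_comm,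
    add_sub_add_right_eq_sub] at this

end IsExtendedSymbol

lemma cls_eq {z : ℂ} (h : Reg z) (p q : ℤ) : cls z p q = QuotientAddGroup.mk (genOf z h p q) :=
  dif_pos h

lemma pbCls_eq {z : ℂ} (h : Reg z) : pbCls z = QuotientAddGroup.mk (pbGen z h) :=
  dif_pos h

lemma sum_cls_eq_zero {w : Fin 5 → ℂ × ℂ} {z : Fin 5 → ℂ} {p q : Fin 5 → ℤ} (hw : w ∈ FThat)
    (hr : ∀ i, Reg (z i)) (h : ∀ i, w i = pt (z i) (p i) (q i)) :
    ∑ i : Fin 5, (-1 : ℤ) ^ (i : ℕ) • cls (z i) (p i) (q i) = 0 := by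
  obtain rfl : w = fun i => pt (z i) (p i) (q i) := funext h
  have key : QuotientAddGroup.mk' relSub (∑ i : Fin 5, (-1 : ℤ) ^ (i : ℕ) •
      genOf (z i) (hr i) (p i) (q i)) = 0 :=
    (QuotientAddGroup.eq_zero_iff _).2
      (AddSubgroup.subset_closure (Or.inl ⟨_, hw, fun i => pt_mem_Cover (hr i) _ _, rfl⟩))
  simp only [map_sum, map_zsmul] at key
  simp only [cls_eq (hr _)]
  exact key

lemma isExtendedSymbol_cls : IsExtendedSymbol cls where
  transfer z hz p q p' q' := by
    have : (QuotientAddGroup.mk (genOf z hz p q + genOf z hz p' q' - genOf z hz p q' -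
        genOf z hz p' q) : EPreBloch) = 0 :=
      (QuotientAddGroup.eq_zero_iff _).2 (AddSubgroup.subset_closure (Or.inr ⟨z, hz, p, q, p', q', rfl⟩))
    simp only [cls_eq hz]
    rw [← sub_eq_zero, ← this]
    simp only [QuotientAddGroup.mk_add, QuotientAddGroup.mk_sub]
    abel
  five x y hxy := by
    obtain ⟨P, Q, H⟩ := exists_lift_mem_FThat hxy
    refine ⟨P 2 - P 1 + P 0, P 3 - P 1 + P 0 - Q 1 + Q 0, P 4 - Q 1 + Q 0, Q 3 - Q 2 + Q 1,
      Q 4 - Q 2 + Q 1 + P 0, ?_⟩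
    rintro p₀ p₁ _ _ _ q₀ q₁ q₂ _ _ rfl rfl rfl rfl rfl
    have := sum_cls_eq_zero (H (p₀ - P 0) (p₁ - P 1) (q₀ - Q 0) (q₁ - Q 1) (q₂ - Q 2))
      (p := ![p₀, p₁, p₁ - p₀ + (P 2 - P 1 + P 0),
        p₁ - p₀ + q₁ - q₀ + (P 3 - P 1 + P 0 - Q 1 + Q 0), q₁ - q₀ + (P 4 - Q 1 + Q 0)])
      (q := ![q₀, q₁, q₂, q₂ - q₁ + (Q 3 - Q 2 + Q 1), q₂ - q₁ - p₀ + (Q 4 - Q 2 + Q 1 + P 0)])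
      hxy.reg_ftTuple (fun i => by
        fin_cases i <;> refine (covAct_pt _ _ _ _ _).trans ?_ <;>
          simp only [Fin.zero_eta, Fin.mk_one, Fin.reduceFinMk, Matrix.cons_val] <;>
          congr 1 <;> ring)
    rw [← this]
    simp only [Fin.sum_univ_five, ftTuple, Matrix.cons_val]
    norm_num
    abel

lemma exp_int_mul_pi (n : ℤ) :
    Complex.exp (n * (Cpi * I)) = 1 ∨ Complex.exp (n * (Cpi * I)) = -1 := by
  rw [← mul_self_eq_one_iff, ← Complex.exp_add, Complex.exp_eq_one_iff]
  exact ⟨n, by rw [Cpi]; ring⟩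

lemma eq_of_pt_eq_pt {z z' : ℂ} (h : Reg z) (h' : Reg z') {p q p' q' : ℤ}
    (e : pt z p q = pt z' p' q') : z = z' ∧ p = p' ∧ q = q' := by
  have hz : z = z' := by
    obtain ⟨e1, e2⟩ := Prod.ext_iff.1 e
    simp only [pt] at e1 e2
    have f1 := congrArg Complex.exp e1
    have f2 := congrArg (fun u => Complex.exp (-u)) e2
    have g1 : 1 - z ≠ 0 := sub_ne_zero.2 h.2.symm
    have g1' : 1 - z' ≠ 0 := sub_ne_zero.2 h'.2.symm
    simp only [neg_add, neg_neg, exp_add, exp_log h.1, exp_log h'.1, exp_log g1, exp_log g1', exp_neg] at f1 f2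
    rcases exp_int_mul_pi p with a | a <;> rcases exp_int_mul_pi p' with a' | a' <;>
    rcases exp_int_mul_pi q with b | b <;> rcases exp_int_mul_pi q' with b' | b' <;>
    rw [a, a'] at f1 <;> rw [b, b'] at f2 <;> norm_num at f1 f2 <;> grind
  subst hz
  have hc : Cpi * I ≠ 0 := mul_ne_zero Cpi_ne_zero I_ne_zero
  simpa [pt, hc] using e

/-- The homomorphism on the free abelian group over `𝓒` with prescribed values on generators. -/
def coverLift {A : Type*} [AddCommGroup A] (f : ℂ → ℤ → ℤ → A) : FreeAbelianGroup CoverT →+ A :=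
  FreeAbelianGroup.lift fun w =>
    f w.2.choose w.2.choose_spec.2.choose w.2.choose_spec.2.choose_spec.choose

lemma coverLift_of {A : Type*} [AddCommGroup A] (f : ℂ → ℤ → ℤ → A) {z : ℂ} (h : Reg z) {p q : ℤ}
    (w : CoverT) (hw : (w : ℂ × ℂ) = pt z p q) :
    coverLift f (FreeAbelianGroup.of w) = f z p q := by
  obtain ⟨e1, e2, e3⟩ := eq_of_pt_eq_pt h w.2.choose_spec.1
    (hw.symm.trans w.2.choose_spec.2.choose_spec.choose_spec)
  rw [coverLift, FreeAbelianGroup.lift_apply_of]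
  exact (congr (congr (congrArg f e1) e2) e3).symm

lemma exists_hom_of_relations {A : Type*} [AddCommGroup A] (f : ℂ → ℤ → ℤ → A)
    (ht : ∀ z, Reg z → ∀ p q p' q', f z p q + f z p' q' = f z p q' + f z p' q)
    (h5 : ∀ x y l, IsLogTuple x y l → rogersSum l = rogersSum baseLog → ∀ k m : Fin 5 → ℤ,
      (∀ i, flat l i = pt (ftTuple x y i) (2 * k i) (2 * m i)) → ∀ p₀ p₁ q₀ q₁ q₂ : ℤ,
      ∑ i : Fin 5, (-1 : ℤ) ^ (i : ℕ) • f (ftTuple x y i)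
        (2 * k i + ![p₀, p₁, p₁ - p₀, p₁ - p₀ + q₁ - q₀, q₁ - q₀] i)
        (2 * m i + ![q₀, q₁, q₂, q₂ - q₁, q₂ - q₁ - p₀] i) = 0) :
    ∃ φ : EPreBloch →+ A, ∀ z, Reg z → ∀ p q, φ (cls z p q) = f z p q := by
  have hle : relSub ≤ (coverLift f).ker := by
    refine (AddSubgroup.closure_le _).2 ?_
    rintro a (⟨w, hw, hc, rfl⟩ | ⟨z, h, p, q, p', q', rfl⟩)
    · obtain ⟨x, y, l, hl, hs, p₀, p₁, q₀, q₁, q₂, e⟩ := exists_of_mem_FThat hw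
      choose hr k m hkm using flat_eq_pt hl
      have := h5 x y l hl hs k m hkm p₀ p₁ q₀ q₁ q₂
      rw [SetLike.mem_coe, AddMonoidHom.mem_ker, map_sum, ← this]
      refine Finset.sum_congr rfl fun i _ => ?_
      rw [map_zsmul, coverLift_of f (hr i)]
      refine (congrFun e i).trans ?_
      simp only [hkm]
      rw [← covAct_pt]
      congr 1
      fin_cases i <;> rfl
    · have hg : ∀ p q, coverLift f (genOf z h p q) = f z p q := fun p q => coverLift_of f h _ rfl
      simp only [SetLike.mem_coe, AddMonoidHom.mem_ker, map_sub, map_add, hg]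
      rw [ht z h, sub_sub, sub_self]
  refine ⟨QuotientAddGroup.lift relSub (coverLift f) hle, fun z h p q => ?_⟩
  rw [cls_eq h]
  exact coverLift_of f h _ rfl

lemma pbCls_five {x y : ℂ} (h : Valid x y) : pbCls x - pbCls y + pbCls (y / x) -
    pbCls ((1 - x⁻¹) / (1 - y⁻¹)) + pbCls ((1 - x) / (1 - y)) = 0 := by
  have r2 : Reg (y / x) := h.reg_ftTuple 2
  have r3 : Reg ((1 - x⁻¹) / (1 - y⁻¹)) := h.reg_ftTuple 3
  have r4 : Reg ((1 - x) / (1 - y)) := h.reg_ftTuple 4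
  rw [pbCls_eq h.1, pbCls_eq h.2.1, pbCls_eq r2, pbCls_eq r3, pbCls_eq r4]
  exact (QuotientAddGroup.eq_zero_iff _).2
    (AddSubgroup.subset_closure ⟨x, y, h.1, h.2.1, h.2.2, r2, r3, r4, rfl⟩)

/-- The natural map from the extended pre-Bloch group to the pre-Bloch group exists. -/
lemma exists_toPreBloch : ∃ Ψ : EPreBloch →+ PreBloch,
    ∀ z, Reg z → ∀ p q, Ψ (cls z p q) = pbCls z := by
  refine exists_hom_of_relations (fun z _ _ => pbCls z) (fun _ _ _ _ _ _ => rfl) ?_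
  intro x y l hl _ k m _ p₀ p₁ q₀ q₁ q₂
  rw [← pbCls_five hl.valid]
  simp only [Fin.sum_univ_five, ftTuple, Matrix.cons_val]
  norm_num
  abel

lemma rogersLift_add (z : ℂ) (k m p q : ℤ) :
    (QuotientAddGroup.mk (rogersLift z (2 * k + p) (2 * m + q)) : ModPiSq) =
      QuotientAddGroup.mk (rogersLift z (2 * k) (2 * m)) +
      QuotientAddGroup.mk (Cpi * I / 2 *
        (q * (pt z (2 * k) (2 * m)).1 - p * (pt z (2 * k) (2 * m)).2)) := by
  rw [← QuotientAddGroup.mk_add]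
  refine mk_eq_of_sub_eq_int_mul (q * k - p * m) ?_
  simp only [rogersLift, pt]
  push_cast
  linear_combination (-(Cpi ^ 2 * (q * k - p * m))) * I_sq

/-- The extended Rogers dilogarithm, up to an additive constant. -/
lemma exists_rogersHom : ∃ ρ : EPreBloch →+ ModPiSq, ∀ z, Reg z → ∀ p q,
    ρ (cls z p q) = QuotientAddGroup.mk (rogersLift z p q) - rogersSum baseLog := by
  refine exists_hom_of_relations
    (fun z p q => QuotientAddGroup.mk (rogersLift z p q) - rogersSum baseLog) ?_ ?_
  · intro z _ p q p' q'
    have : (QuotientAddGroup.mk (rogersLift z p q + rogersLift z p' q') : ModPiSq) =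
        QuotientAddGroup.mk (rogersLift z p q' + rogersLift z p' q) := by
      congr 1
      simp only [rogersLift]
      ring
    simp only [QuotientAddGroup.mk_add] at this
    rw [sub_add_sub_comm, this, sub_add_sub_comm]
  · intro x y l hl hs k m hkm p₀ p₁ q₀ q₁ q₂
    have hr := hl.valid.reg_ftTuple
    have e : ∀ i, (QuotientAddGroup.mk (rogersLift (ftTuple x y i) (2 * k i) (2 * m i)) : ModPiSq)
        = rogersEven (flat l i) := fun i => by rw [hkm, rogersEven_pt (hr i)]
    simp only [rogersLift_add, e, ← hkm]
    set p : Fin 5 → ℤ := ![p₀, p₁, p₁ - p₀, p₁ - p₀ + q₁ - q₀, q₁ - q₀] with hp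
    set q : Fin 5 → ℤ := ![q₀, q₁, q₂, q₂ - q₁, q₂ - q₁ - p₀] with hq
    have h0 : ∑ i : Fin 5, (-1 : ℤ) ^ (i : ℕ) • (QuotientAddGroup.mk
        (Cpi * I / 2 * (q i * (flat l i).1 - p i * (flat l i).2)) : ModPiSq) = 0 := by
      have h1 : ∑ i : Fin 5, (-1 : ℤ) ^ (i : ℕ) •
          (Cpi * I / 2 * (q i * (flat l i).1 - p i * (flat l i).2)) = 0 := by
        simp only [Fin.sum_univ_five, hp, hq, flat, Matrix.cons_val]
        norm_num
        ring
      have h2 := congrArg (QuotientAddGroup.mk' (AddSubgroup.zmultiples (Cpi ^ 2))) h1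
      simp only [map_sum, map_zsmul, map_zero] at h2
      exact h2
    have hc : ∑ i : Fin 5, (-1 : ℤ) ^ (i : ℕ) • rogersSum baseLog = rogersSum baseLog := by
      rw [← Finset.sum_smul]
      norm_num [Fin.sum_univ_five]
    simp only [zsmul_sub, zsmul_add, Finset.sum_sub_distrib, Finset.sum_add_distrib, h0, hc]
    rw [← hs, rogersSum, add_zero, sub_self]

lemma chi_injective : Function.Injective isExtendedSymbol_cls.chi := by
  rw [injective_iff_map_eq_zero]
  intro u hu
  obtain ⟨u, rfl⟩ := Additive.ofMul.surjective u
  rw [ofMul_eq_zero]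
  by_contra h
  have h1 : (u : ℂ) ≠ 1 := fun e => h (Units.ext e)
  have hr : Reg u := ⟨u.ne_zero, h1⟩
  obtain ⟨ρ, hρ⟩ := exists_rogersHom
  have := isExtendedSymbol_cls.chi_apply u.ne_zero h1
  rw [Units.mk0_val, hu] at this
  have h2 := congrArg ρ this
  rw [map_zero, map_sub, hρ _ hr, hρ _ hr, sub_sub_sub_cancel_right, ← QuotientAddGroup.mk_sub,
    eq_comm, QuotientAddGroup.eq_zero_iff, AddSubgroup.mem_zmultiples_iff] at h2
  obtain ⟨n, hn⟩ := h2
  simp only [rogersLift] at hn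
  push_cast at hn
  have hlog : Complex.log u = ((-n : ℤ) : ℂ) * (2 * Real.pi * I) := by
    refine mul_left_cancel₀ (div_ne_zero (mul_ne_zero Cpi_ne_zero I_ne_zero) two_ne_zero) ?_
    rw [zsmul_eq_mul] at hn
    change _ = Cpi * I / 2 * (_ * (2 * Cpi * I))
    push_cast
    linear_combination n * Cpi ^ 2 * I_sq - hn
  apply h1
  rw [← exp_log u.ne_zero, hlog, Complex.exp_int_mul_two_pi_mul_I]

lemma exists_fromPreBloch : ∃ Θ : PreBloch →+ EPreBloch ⧸ isExtendedSymbol_cls.chi.range,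
    ∀ z, Reg z → Θ (pbCls z) = QuotientAddGroup.mk (cls z 0 0) := by
  set F : FreeAbelianGroup RegT →+ EPreBloch ⧸ isExtendedSymbol_cls.chi.range :=
    FreeAbelianGroup.lift fun z => QuotientAddGroup.mk (cls z 0 0) with hF
  have hgen : ∀ z hz, F (pbGen z hz) = QuotientAddGroup.mk (cls z 0 0) := fun z hz =>
    FreeAbelianGroup.lift_apply_of _ _
  have hle : pbSub ≤ F.ker := by
    refine (AddSubgroup.closure_le _).2 ?_
    rintro a ⟨x, y, hx, hy, hxy, r2, r3, r4, rfl⟩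
    obtain ⟨a, b, d, e, f, H⟩ := isExtendedSymbol_cls.five x y ⟨hx, hy, hxy⟩
    have h0 := congrArg (QuotientAddGroup.mk' isExtendedSymbol_cls.chi.range)
      (H 0 0 _ _ _ 0 0 0 _ _ rfl rfl rfl rfl rfl)
    have hm : ∀ z, Reg z → ∀ p q, QuotientAddGroup.mk' isExtendedSymbol_cls.chi.range (cls z p q) =
        QuotientAddGroup.mk (cls z 0 0) := fun z hz p q =>
      (QuotientAddGroup.eq_iff_sub_mem).2 (isExtendedSymbol_cls.sub_mem_range hz p q)
    simp only [map_add, map_sub, hm _ hx, hm _ hy, hm _ r2, hm _ r3, hm _ r4, map_zero] at h0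
    simp only [SetLike.mem_coe, AddMonoidHom.mem_ker, map_add, map_sub, hgen, h0]
  refine ⟨QuotientAddGroup.lift pbSub F hle, fun z hz => ?_⟩
  rw [pbCls_eq hz]
  exact hgen z hz

lemma addMonoidHom_ext_cls {A : Type*} [AddCommGroup A] {φ ψ : EPreBloch →+ A}
    (h : ∀ z, Reg z → ∀ p q, φ (cls z p q) = ψ (cls z p q)) : φ = ψ := by
  refine QuotientAddGroup.addMonoidHom_ext _ (FreeAbelianGroup.lift_ext _ _ ?_)
  rintro ⟨_, z, hz, p, q, rfl⟩
  have := h z hz p q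
  rwa [cls_eq hz] at this

/-- the sequence `0 → ℂ* → êP(ℂ) → P(ℂ) → 0` is exact, where the second map is
the natural map `[z,p,q] ↦ [z]` and the first is an injective homomorphism `χ` with
`χ(z) = [z,0,1] - [z,0,0]` for `z ∈ ℂ ∖ {0,1}`. -/
theorem stmt16 :
    ∃ (Ψ : EPreBloch →+ PreBloch) (χ : Additive ℂˣ →+ EPreBloch),
      (∀ (z : ℂ), Reg z → ∀ (p q : ℤ), Ψ (cls z p q) = pbCls z) ∧
      (∀ (z : ℂ) (h0 : z ≠ 0), z ≠ 1 →
        χ (Additive.ofMul (Units.mk0 z h0)) = cls z 0 1 - cls z 0 0) ∧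
      Function.Injective χ ∧ Function.Surjective Ψ ∧ χ.range = Ψ.ker := by
  obtain ⟨Ψ, hΨ⟩ := exists_toPreBloch
  obtain ⟨Θ, hΘ⟩ := exists_fromPreBloch
  refine ⟨Ψ, isExtendedSymbol_cls.chi, hΨ, fun z h0 h1 => isExtendedSymbol_cls.chi_apply h0 h1,
    chi_injective, ?_, le_antisymm ?_ ?_⟩
  · rw [← AddMonoidHom.range_eq_top, eq_top_iff]
    rintro a -
    obtain ⟨a, rfl⟩ := QuotientAddGroup.mk_surjective a
    induction a using FreeAbelianGroup.induction_on with
    | zero => exact zero_mem _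
    | of z => exact ⟨cls z 0 0, (hΨ z z.2 0 0).trans (pbCls_eq z.2)⟩
    | neg z h => exact neg_mem h
    | add a b ha hb => exact add_mem ha hb
  · rintro _ ⟨u, rfl⟩
    obtain ⟨u, rfl⟩ := Additive.ofMul.surjective u
    by_cases h1 : (u : ℂ) = 1
    · have : u = 1 := Units.ext h1
      rw [this, ofMul_one, map_zero]
      exact zero_mem _
    · have hr : Reg u := ⟨u.ne_zero, h1⟩
      have := isExtendedSymbol_cls.chi_apply u.ne_zero h1
      rw [Units.mk0_val] at this
      rw [AddMonoidHom.mem_ker, this, map_sub, hΨ _ hr, hΨ _ hr, sub_self]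
  · intro a ha
    have hcomp : Θ.comp Ψ = QuotientAddGroup.mk' isExtendedSymbol_cls.chi.range :=
      addMonoidHom_ext_cls fun z hz p q => by
        rw [AddMonoidHom.comp_apply, hΨ z hz, hΘ z hz]
        exact (QuotientAddGroup.eq_iff_sub_mem.2
          (isExtendedSymbol_cls.sub_mem_range hz p q)).symm
    have := DFunLike.congr_fun hcomp a
    rw [AddMonoidHom.comp_apply, (AddMonoidHom.mem_ker).1 ha, map_zero] at this
    exact (QuotientAddGroup.eq_zero_iff a).1 this.symm

end ExtendedBloch

end
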